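/- Let (𝔊,Φ) be a structurally compatible affine cellular automaton of radius 1 on an irreducible topological Markov chain 𝔊 whose topological entropy satisfies h(𝔊) = log p for a prime number p. Let μ be a Borel probability measure on 𝔊 invariant under both Φ and the shift σ. If μ is ergodic for σ and the Kolmogorov–Sinai entropy h_μ(Φ) is positive, then μ is the Parry measure of 𝔊. -/

import Mathlib

open Filter Topology MeasureTheory
open scoped ENNReal

namespace CAStmt

/-- The shift map on bi-infinite sequences. -/
def shiftMap {G : Type*} (x : ℤ → G) : ℤ → G := fun n => x (n + 1)

/-- The topological Markov chain determined by the transition set `E`. -/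
def TMC {G : Type*} (E : Set (G × G)) : Set (ℤ → G) := {x | ∀ i : ℤ, (x i, x (i + 1)) ∈ E}

/-- The word `w` occurs in some point of `X`. -/
def WordIn {G : Type*} (X : Set (ℤ → G)) {m : ℕ} (w : Fin m → G) : Prop :=
  ∃ x ∈ X, ∃ j : ℤ, ∀ i : Fin m, x (j + ((i : ℕ) : ℤ)) = w i

/-- Every letter of the alphabet occurs in some point of the TMC. -/
def EveryLetterOccurs {G : Type*} (E : Set (G × G)) : Prop :=
  ∀ g : G, ∃ x ∈ TMC E, ∃ i : ℤ, x i = g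

/-- The radius-1 cellular automaton map with local rule `φ`. -/
def CA {G : Type*} (φ : G → G → G) (x : ℤ → G) : ℤ → G := fun j => φ (x j) (x (j + 1))

/-- Structural compatibility of the local rule `φ` with the TMC of `E`. -/
def SC {G : Type*} (E : Set (G × G)) (φ : G → G → G) : Prop :=
  ∀ x ∈ TMC E, ∀ y ∈ TMC E, (fun i => φ (x i) (y i)) ∈ TMC E

def RightPerm {G : Type*} (φ : G → G → G) : Prop := ∀ a, Function.Bijective (φ a)

def LeftPerm {G : Type*} (φ : G → G → G) : Prop := ∀ b, Function.Bijective (fun a => φ a b)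

/-- Irreducibility: any two letters are joined by an allowed word `(u,v₁,…,v_k,w)`, `k ≥ 1`. -/
def IrreducibleTMC {G : Type*} (E : Set (G × G)) : Prop :=
  ∀ u w : G, ∃ x ∈ TMC E, ∃ i j : ℤ, i + 1 < j ∧ x i = u ∧ x j = w

/-- Mixing with mixing constant `q`. -/
def MixingTMCWith {G : Type*} (E : Set (G × G)) (q : ℕ) : Prop :=
  1 ≤ q ∧ ∀ k : ℕ, q ≤ k → ∀ u w : G,
    ∃ x ∈ TMC E, ∃ i : ℤ, x i = u ∧ x (i + (k : ℤ) + 1) = w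

def MixingTMC {G : Type*} (E : Set (G × G)) : Prop := ∃ q, MixingTMCWith E q

/-- `Φ` is `N`-scaling on `X`: `(Φ^N x)₀ = φ(x₀, x_N)`. -/
def NScalingOn {G : Type*} (X : Set (ℤ → G)) (φ : G → G → G) (N : ℕ) : Prop :=
  ∀ x ∈ X, (CA φ)^[N] x 0 = φ (x 0) (x (N : ℤ))

/-- The TMC `𝔥(𝔽,τ,n)` over the alphabet `F × Fin n`. -/
def hTMC {F : Type*} (τ : Equiv.Perm F) (n : ℕ) : Set (ℤ → F × Fin n) :=
  TMC {p : (F × Fin n) × (F × Fin n) | p.2.1 = τ p.1.1}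

/-- `op` is a `k`-block operation (memory 0, anticipation `k-1`) closed on `Λ`. -/
def KBlockOp {A : Type*} (Λ : Set (ℤ → A)) (k : ℕ)
    (op : (ℤ → A) → (ℤ → A) → (ℤ → A)) : Prop :=
  (∀ x ∈ Λ, ∀ y ∈ Λ, op x y ∈ Λ) ∧
  ∃ ρ : (Fin k → A) → (Fin k → A) → A,
    ∀ x ∈ Λ, ∀ y ∈ Λ, ∀ j : ℤ,
      op x y j = ρ (fun i => x (j + ((i : ℕ) : ℤ))) (fun i => y (j + ((i : ℕ) : ℤ)))

/-- `op` is a quasigroup operation on `Λ`: all translations are bijections of `Λ`. -/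
def QuasigroupOp {A : Type*} (Λ : Set (ℤ → A)) (op : (ℤ → A) → (ℤ → A) → (ℤ → A)) : Prop :=
  ∀ z ∈ Λ, Set.BijOn (fun x => op x z) Λ Λ ∧ Set.BijOn (fun y => op z y) Λ Λ

/-- A 1-block topological conjugacy between `(X,Φ)` and `(Y,Ψ)` induced by the letter map `θ`. -/
def OneBlockConjugacy {A B : Type*} (X : Set (ℤ → A)) (Φ : (ℤ → A) → (ℤ → A))
    (Y : Set (ℤ → B)) (Ψ : (ℤ → B) → (ℤ → B)) (θ : A → B) : Prop :=
  Set.BijOn (fun x => θ ∘ x) X Y ∧ ∀ x ∈ X, θ ∘ (Φ x) = Ψ (θ ∘ x)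

/-- `add` is an abelian group operation. -/
def IsAbelianGroupOp {K : Type*} (add : K → K → K) : Prop :=
  (∀ a b c, add (add a b) c = add a (add b c)) ∧ (∀ a b, add a b = add b a) ∧
  ∃ z : K, (∀ a, add z a = a) ∧ ∀ a, ∃ b, add a b = z

/-- The product transition set on `K × B`. -/
def prodE {K B : Type*} (EK : Set (K × K)) (EB : Set (B × B)) : Set ((K × B) × (K × B)) :=
  {p | (p.1.1, p.2.1) ∈ EK ∧ (p.1.2, p.2.2) ∈ EB}

/-- `φK` is an affine local rule for the abelian group operation `add`. -/
def IsAffineRuleExpl {K : Type*} (add : K → K → K) (φK : K → K → K) : Prop :=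
  IsAbelianGroupOp add ∧
  ∃ (η ρc : K → K) (c : K), Function.Bijective η ∧ Function.Bijective ρc ∧
    (∀ a b, η (add a b) = add (η a) (η b)) ∧ (∀ a b, ρc (add a b) = add (ρc a) (ρc b)) ∧
    (∀ a, η (ρc a) = ρc (η a)) ∧
    ∀ a b, φK a b = add (add (η a) (ρc b)) c

/-- The cylinder on the word `w` at coordinates `0,…,m-1`. -/
def cyl {A : Type*} {m : ℕ} (w : Fin m → A) : Set (ℤ → A) :=
  {x | ∀ i : Fin m, x ((i : ℕ) : ℤ) = w i}

/-- A past: `p i` is the letter at coordinate `-(i+1)`; all transitions allowed. -/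
def IsPast {A : Type*} (E : Set (A × A)) (p : ℕ → A) : Prop :=
  ∀ i : ℕ, (p (i + 1), p i) ∈ E

/-- The word `(w_{-m},…,w_{-1})` of the past `p`. -/
def pastWord {A : Type*} (p : ℕ → A) (m : ℕ) : Fin m → A :=
  fun j => p (m - 1 - (j : ℕ))

/-- `μ` has complete connections (compatible with the TMC of `E`) and summable decay. -/
def CCSD {A : Type*} [MeasurableSpace A] (E : Set (A × A)) (μ : Measure (ℤ → A)) : Prop :=
  ∃ ν : (ℕ → A) → A → ℝ,
    (∀ p, IsPast E p → ∀ a, (p 0, a) ∈ E →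
      0 < ν p a ∧
      Tendsto (fun m : ℕ =>
          (μ (cyl (Fin.snoc (pastWord p m) a))).toReal / (μ (cyl (pastWord p m))).toReal)
        atTop (nhds (ν p a))) ∧
    ∃ γ : ℕ → ℝ, Summable γ ∧
      ∀ m : ℕ, 1 ≤ m → ∀ p q, IsPast E p → IsPast E q → (∀ i < m, p i = q i) →
        ∀ a, (p 0, a) ∈ E → |ν p a / ν q a - 1| ≤ γ m

/-- A shift-invariant probability measure carried by the TMC of `E`, positive on allowed
cylinders. -/
def GoodMeasure {A : Type*} [MeasurableSpace A] (E : Set (A × A)) (μ : Measure (ℤ → A)) : Prop :=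
  IsProbabilityMeasure μ ∧ Measure.map shiftMap μ = μ ∧ μ (TMC E) = 1 ∧
  ∀ (m : ℕ) (w : Fin m → A), WordIn (TMC E) w → 0 < μ (cyl w)

/-- The identification of `𝔽 × Σ_n` with `𝔥(𝔽,τ,n)`. -/
def ident {F : Type*} (τ : Equiv.Perm F) {n : ℕ} (f : F) (y : ℤ → Fin n) : ℤ → F × Fin n :=
  fun i => ((τ ^ i) f, y i)

/-- A quasigroup operation on an alphabet. -/
def QuasigroupPointOp {K : Type*} (o : K → K → K) : Prop :=
  ∀ a, Function.Bijective (fun x => o x a) ∧ Function.Bijective (o a)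

/-- The data witnessing that an SC bipermutative c.a. is regular and simple. -/
def RegularSimpleData {K F : Type*} (EK : Set (K × K)) (φK : K → K → K)
    (τ : Equiv.Perm F) (n k : ℕ)
    (op : (ℤ → F × Fin n) → (ℤ → F × Fin n) → (ℤ → F × Fin n))
    (θ : K → F × Fin n) (oF : F → F → F) (oS : Fin n → Fin n → Fin n) : Prop :=
  1 ≤ n ∧ 1 ≤ k ∧
  KBlockOp (hTMC τ n) k op ∧ QuasigroupOp (hTMC τ n) op ∧
  OneBlockConjugacy (TMC EK) (CA φK) (hTMC τ n) (fun x => op x (shiftMap x)) θ ∧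
  QuasigroupPointOp oF ∧ QuasigroupPointOp oS ∧
  ∀ (f g : F) (y z : ℤ → Fin n),
    op (ident τ f y) (ident τ g z) = ident τ (oF f g) (fun i => oS (y i) (z i))

/-- An SC bipermutative c.a. is regular and simple. -/
def RegularSimple {K : Type*} (EK : Set (K × K)) (φK : K → K → K) : Prop :=
  ∃ (F : Type) (_ : Fintype F) (τ : Equiv.Perm F) (n k : ℕ)
    (op : (ℤ → F × Fin n) → (ℤ → F × Fin n) → (ℤ → F × Fin n))
    (θ : K → F × Fin n) (oF : F → F → F) (oS : Fin n → Fin n → Fin n),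
    RegularSimpleData EK φK τ n k op θ oF oS

/-- Weak-* convergence of the Cesàro means of `μ` under `Φ` to `κ`. -/
def CesaroTendstoTo {G : Type*} [TopologicalSpace G] [MeasurableSpace G]
    (μ : Measure (ℤ → G)) (Φ : (ℤ → G) → (ℤ → G)) (κ : Measure (ℤ → G)) : Prop :=
  ∀ f : C(ℤ → G, ℝ), Tendsto
    (fun N : ℕ => (N : ℝ)⁻¹ * ∑ n ∈ Finset.range N, ∫ x, f (Φ^[n] x) ∂μ)
    atTop (nhds (∫ x, f x ∂κ))

/-- `κ` is the Parry measure of the irreducible TMC of `E`. -/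
def IsParryMeasure {G : Type*} [Fintype G] [MeasurableSpace G] (E : Set (G × G))
    (κ : Measure (ℤ → G)) : Prop :=
  IsProbabilityMeasure κ ∧ Measure.map shiftMap κ = κ ∧
  ∃ (lam : ℝ) (r l : G → ℝ), 0 < lam ∧ (∀ a, 0 < r a) ∧ (∀ a, 0 < l a) ∧
    (∀ a : G, (∑ b : G, E.indicator (fun _ => r b) (a, b)) = lam * r a) ∧
    (∀ b : G, (∑ a : G, E.indicator (fun _ => l a) (a, b)) = lam * l b) ∧
    (∑ a : G, l a * r a) = 1 ∧
    ∀ (m : ℕ) (w : Fin (m + 1) → G), WordIn (TMC E) w →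
      (κ (cyl w)).toReal = l (w 0) * r (w (Fin.last m)) / lam ^ m

/-- Entropy of the refinement `P ∨ T⁻¹P ∨ ⋯ ∨ T^{-(n-1)}P`. -/
noncomputable def joinEntropy {X : Type*} [MeasurableSpace X] (μ : Measure X) (T : X → X)
    {r : ℕ} (P : Fin r → Set X) (n : ℕ) : ℝ :=
  -∑ c : Fin n → Fin r,
      ((μ (⋂ i : Fin n, T^[(i : ℕ)] ⁻¹' P (c i))).toReal *
        Real.log (μ (⋂ i : Fin n, T^[(i : ℕ)] ⁻¹' P (c i))).toReal)

/-- The Kolmogorov–Sinai entropy `h_μ(T)` is positive: some finite measurable partition has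
positive entropy. -/
def KSEntropyPos {X : Type*} [MeasurableSpace X] (μ : Measure X) (T : X → X) : Prop :=
  ∃ (r : ℕ) (P : Fin r → Set X), (∀ i, MeasurableSet (P i)) ∧
    Pairwise (Function.onFun Disjoint P) ∧ (⋃ i, P i) = Set.univ ∧
    0 < Filter.liminf (fun n : ℕ => joinEntropy μ T P n / n) Filter.atTop

end CAStmt

namespace CAStmt

/-! ### Entropy of finite-valued functions -/

/-- The Shannon entropy of the law of `f`. -/
noncomputable def ent {X A : Type*} [MeasurableSpace X] [Fintype A] (μ : Measure X)
    (f : X → A) : ℝ :=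
  ∑ a, Real.negMulLog (μ.real (f ⁻¹' {a}))

lemma negMulLog_sum_le {ι : Type*} (s : Finset ι) (x : ι → ℝ) (hx : ∀ i ∈ s, 0 ≤ x i) :
    Real.negMulLog (∑ i ∈ s, x i) ≤ ∑ i ∈ s, Real.negMulLog (x i) := by
  simp only [Real.negMulLog, neg_mul, Finset.sum_mul, ← Finset.sum_neg_distrib]
  refine Finset.sum_le_sum fun i hi => ?_
  rcases (hx i hi).eq_or_lt with h | h
  · simp [← h]
  · have := Real.log_le_log h (Finset.single_le_sum hx hi)
    nlinarith

lemma mul_log_le {q a b Q : ℝ} (hq : 0 ≤ q) (ha : q ≤ a) (hb : q ≤ b) (hQ : q ≤ Q) :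
    q * (Real.log a + Real.log b - Real.log q - Real.log Q) ≤ a * b / Q - q := by
  rcases hq.eq_or_lt with h | h
  · subst h
    simp only [zero_mul, sub_zero]
    positivity
  · have ha' := h.trans_le ha
    have hb' := h.trans_le hb
    have hQ' := h.trans_le hQ
    have h1 := Real.log_le_sub_one_of_pos (x := a * b / (q * Q)) (by positivity)
    rw [Real.log_div (by positivity) (by positivity), Real.log_mul ha'.ne' hb'.ne',
      Real.log_mul h.ne' hQ'.ne'] at h1
    calc q * (Real.log a + Real.log b - Real.log q - Real.log Q)
        ≤ q * (a * b / (q * Q) - 1) := by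
          apply mul_le_mul_of_nonneg_left _ hq
          linarith
      _ = a * b / Q - q := by field_simp

/-- Subadditivity of entropy for unnormalised distributions on a product. -/
lemma sum_negMulLog_add_le {A B : Type*} [Fintype A] [Fintype B] (q : A → B → ℝ)
    (hq : ∀ a b, 0 ≤ q a b) :
    ∑ a, ∑ b, Real.negMulLog (q a b) + Real.negMulLog (∑ a, ∑ b, q a b)
      ≤ ∑ a, Real.negMulLog (∑ b, q a b) + ∑ b, Real.negMulLog (∑ a, q a b) := by
  set Q := ∑ a, ∑ b, q a b with hQ
  have hQ' : Q = ∑ b, ∑ a, q a b := Finset.sum_comm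
  have hA : ∀ a b, q a b ≤ ∑ b, q a b := fun a b =>
    Finset.single_le_sum (f := fun b => q a b) (fun b _ => hq a b) (Finset.mem_univ b)
  have hB : ∀ a b, q a b ≤ ∑ a, q a b := fun a b =>
    Finset.single_le_sum (f := fun a => q a b) (fun a _ => hq a b) (Finset.mem_univ a)
  have hAQ : ∀ a, ∑ b, q a b ≤ Q := fun a =>
    Finset.single_le_sum (f := fun a => ∑ b, q a b)
      (fun a _ => Finset.sum_nonneg fun b _ => hq a b) (Finset.mem_univ a)
  have key : ∑ a, ∑ b, q a b * (Real.log (∑ b, q a b) + Real.log (∑ a, q a b)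
      - Real.log (q a b) - Real.log Q)
      ≤ ∑ a, ∑ b, ((∑ b, q a b) * (∑ a, q a b) / Q - q a b) :=
    Finset.sum_le_sum fun a _ => Finset.sum_le_sum fun b _ =>
      mul_log_le (hq a b) (hA a b) (hB a b) ((hA a b).trans (hAQ a))
  have hR : ∑ a, ∑ b, ((∑ b, q a b) * (∑ a, q a b) / Q - q a b) = 0 := by
    simp only [Finset.sum_sub_distrib, ← hQ, ← Finset.sum_div, ← Finset.mul_sum, ← Finset.sum_mul,
      ← hQ']
    by_cases h : Q = 0
    · simp [h]
    · field_simp; ring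
  have h1 : ∑ a, ∑ b, q a b * Real.log (∑ b, q a b) = -∑ a, Real.negMulLog (∑ b, q a b) := by
    simp [Real.negMulLog, Finset.sum_mul]
  have h2 : ∑ a, ∑ b, q a b * Real.log (∑ a, q a b) = -∑ b, Real.negMulLog (∑ a, q a b) := by
    rw [Finset.sum_comm]; simp [Real.negMulLog, Finset.sum_mul]
  have h3 : ∑ a, ∑ b, q a b * Real.log (q a b) = -∑ a, ∑ b, Real.negMulLog (q a b) := by
    simp [Real.negMulLog]
  have h4 : ∑ a, ∑ b, q a b * Real.log Q = -Real.negMulLog Q := by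
    simp [Real.negMulLog, ← Finset.sum_mul, hQ]
  simp only [mul_sub, mul_add, Finset.sum_sub_distrib, Finset.sum_add_distrib] at key
  simp only [Finset.sum_sub_distrib] at hR
  linarith

lemma ent_comp_measurePreserving {X A : Type*} [MeasurableSpace X] {μ : Measure X} [Fintype A]
    [MeasurableSpace A] [MeasurableSingletonClass A] {f : X → A} (hf : Measurable f) {T : X → X}
    (hT : MeasurePreserving T μ μ) : ent μ (f ∘ T) = ent μ f := by
  unfold ent
  refine Finset.sum_congr rfl fun a _ => ?_
  rw [Set.preimage_comp, hT.measureReal_preimage (hf (measurableSet_singleton a)).nullMeasurableSet]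

section

variable {X : Type*} [MeasurableSpace X] {μ : Measure X} [IsFiniteMeasure μ]

/-- Fibre decomposition of the law of a finite-valued function. -/
lemma measureReal_preimage_eq_sum {A : Type*} [Fintype A] [MeasurableSpace A]
    [MeasurableSingletonClass A] {f : X → A} (hf : Measurable f) (s : Set X)
    (hs : MeasurableSet s) :
    μ.real s = ∑ a, μ.real (f ⁻¹' {a} ∩ s) := by
  have := measureReal_biUnion_finset (μ := μ) (s := Finset.univ) (f := fun a => f ⁻¹' {a} ∩ s)
    (by
      intro a _ b _ hab
      refine Set.disjoint_left.2 fun x hx hy => hab ?_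
      exact hx.1.symm.trans hy.1)
    (fun a _ => (hf (measurableSet_singleton a)).inter hs)
  rw [← this]
  congr 1
  ext x
  simp

lemma ent_comp_le {A B : Type*} [Fintype A] [Fintype B] [MeasurableSpace A]
    [MeasurableSingletonClass A] {f : X → A} (hf : Measurable f) (φ : A → B) :
    ent μ (φ ∘ f) ≤ ent μ f := by
  classical
  have h : ∀ b, μ.real ((φ ∘ f) ⁻¹' {b}) =
      ∑ a ∈ Finset.univ.filter (fun a => φ a = b), μ.real (f ⁻¹' {a}) := by
    intro b
    rw [← measureReal_biUnion_finset]
    · congr 1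
      ext x; simp
    · intro a _ a' _ haa
      refine Set.disjoint_left.2 fun x hx hy => haa ?_
      exact hx.symm.trans hy
    · exact fun a _ => hf (measurableSet_singleton a)
  unfold ent
  rw [← Finset.sum_fiberwise (s := Finset.univ) (g := φ)]
  refine Finset.sum_le_sum fun b _ => ?_
  rw [h]
  exact negMulLog_sum_le _ _ fun _ _ => measureReal_nonneg

lemma ent_le_of_eq_comp {A B : Type*} [Fintype A] [Fintype B] [MeasurableSpace A]
    [MeasurableSingletonClass A] {f : X → A} (hf : Measurable f) {g : X → B} (φ : A → B)
    (h : ∀ x, g x = φ (f x)) : ent μ g ≤ ent μ f := by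
  obtain rfl : g = φ ∘ f := funext h
  exact ent_comp_le hf φ

/-- Strong subadditivity of entropy. -/
lemma ent_submodular {A B C : Type*} [Fintype A] [Fintype B] [Fintype C] [MeasurableSpace A]
    [MeasurableSingletonClass A] [MeasurableSpace B] [MeasurableSingletonClass B]
    [MeasurableSpace C] [MeasurableSingletonClass C] {f : X → A} {g : X → B} {k : X → C}
    (hf : Measurable f) (hg : Measurable g) (hk : Measurable k) :
    ent μ (fun x => (f x, g x, k x)) + ent μ k
      ≤ ent μ (fun x => (f x, k x)) + ent μ (fun x => (g x, k x)) := by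
  have key := fun c => sum_negMulLog_add_le
    (fun a b => μ.real ((fun x => (f x, g x, k x)) ⁻¹' {(a, b, c)}))
    (fun _ _ => measureReal_nonneg)
  have hm : ∀ a b c, (fun x => (f x, g x, k x)) ⁻¹' {(a, b, c)}
      = f ⁻¹' {a} ∩ (g ⁻¹' {b} ∩ k ⁻¹' {c}) := by
    intros; ext; simp
  have hm1 : ∀ a c, (fun x => (f x, k x)) ⁻¹' {(a, c)} = f ⁻¹' {a} ∩ k ⁻¹' {c} := by
    intros; ext; simp
  have hm2 : ∀ b c, (fun x => (g x, k x)) ⁻¹' {(b, c)} = g ⁻¹' {b} ∩ k ⁻¹' {c} := by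
    intros; ext; simp
  have mf := fun a => hf (measurableSet_singleton a)
  have mg := fun a => hg (measurableSet_singleton a)
  have mk := fun a => hk (measurableSet_singleton a)
  have s1 : ∀ b c, ∑ a, μ.real (f ⁻¹' {a} ∩ (g ⁻¹' {b} ∩ k ⁻¹' {c}))
      = μ.real (g ⁻¹' {b} ∩ k ⁻¹' {c}) := fun b c =>
    (measureReal_preimage_eq_sum hf _ ((mg b).inter (mk c))).symm
  have s2 : ∀ a c, ∑ b, μ.real (f ⁻¹' {a} ∩ (g ⁻¹' {b} ∩ k ⁻¹' {c}))
      = μ.real (f ⁻¹' {a} ∩ k ⁻¹' {c}) := fun a c => by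
    rw [measureReal_preimage_eq_sum hg _ ((mf a).inter (mk c))]
    simp only [Set.inter_left_comm]
  have s3 : ∀ c, ∑ a, μ.real (f ⁻¹' {a} ∩ k ⁻¹' {c}) = μ.real (k ⁻¹' {c}) := fun c =>
    (measureReal_preimage_eq_sum hf _ (mk c)).symm
  simp only [hm, s1, s2, s3] at key
  have := Finset.sum_le_sum fun c (_ : c ∈ Finset.univ) => key c
  simp only [Finset.sum_add_distrib] at this
  unfold ent
  simp only [Fintype.sum_prod_type, hm, hm1, hm2]
  rw [Finset.sum_comm (f := fun c a => Real.negMulLog (μ.real (f ⁻¹' {a} ∩ k ⁻¹' {c}))),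
    Finset.sum_comm (f := fun c b => Real.negMulLog (μ.real (g ⁻¹' {b} ∩ k ⁻¹' {c}))),
    Finset.sum_comm] at this
  rw [Finset.sum_congr rfl fun a _ => Finset.sum_comm (f := fun c b => _)] at this
  exact this

/-- `f` has small conditional entropy given any good approximation of `f`. -/
lemma exists_ent_pair_sub_lt {A : Type*} [Fintype A] [MeasurableSpace A]
    [MeasurableSingletonClass A] {f : X → A} (hf : Measurable f) {ε : ℝ} (hε : 0 < ε) :
    ∃ δ > 0, ∀ g : X → A, Measurable g → μ.real {x | g x ≠ f x} < δ →
      ent μ (fun x => (f x, g x)) - ent μ g < ε := by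
  classical
  -- entropy is uniformly close when the functions agree outside a small set
  have cont : ∀ {B : Type _} [Fintype B] [MeasurableSpace B] [MeasurableSingletonClass B]
      {h : X → B}, Measurable h → ∀ ε > 0, ∃ δ > 0, ∀ g : X → B, Measurable g →
      μ.real {x | g x ≠ h x} < δ → |ent μ g - ent μ h| < ε := by
    intro B _ _ _ h hh ε hε
    have hc : Continuous fun v : B → ℝ => ∑ b, Real.negMulLog (v b) :=
      continuous_finsetSum _ fun b _ => Real.continuous_negMulLog.comp (continuous_apply b)
    obtain ⟨δ, hδ, H⟩ := Metric.continuous_iff.1 hc (fun b => μ.real (h ⁻¹' {b})) ε hε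
    refine ⟨δ, hδ, fun g hg hgh => H (fun b => μ.real (g ⁻¹' {b})) ?_⟩
    rw [dist_pi_lt_iff hδ]
    intro b
    refine lt_of_le_of_lt ?_ hgh
    rw [Real.dist_eq]
    refine (abs_measureReal_sub_le_measureReal_symmDiff
      (hg (measurableSet_singleton b)).nullMeasurableSet
      (hh (measurableSet_singleton b)).nullMeasurableSet).trans (measureReal_mono ?_)
    rintro x (⟨h1, h2⟩ | ⟨h1, h2⟩) heq
    · exact h2 (heq.symm.trans h1)
    · exact h2 (heq.trans h1)
  obtain ⟨δ₁, hδ₁, H₁⟩ := cont (hf.prodMk hf) (ε / 2) (half_pos hε)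
  obtain ⟨δ₂, hδ₂, H₂⟩ := cont hf (ε / 2) (half_pos hε)
  refine ⟨min δ₁ δ₂, lt_min hδ₁ hδ₂, fun g hg h => ?_⟩
  have e1 := H₁ (fun x => (f x, g x)) (hf.prodMk hg) (lt_of_le_of_lt (measureReal_mono
    (fun x hx => by simpa using hx)) (h.trans_le (min_le_left _ _)))
  have e2 := H₂ g hg (h.trans_le (min_le_right _ _))
  have e3 : ent μ (fun x => (f x, f x)) ≤ ent μ f := ent_le_of_eq_comp hf (fun a => (a, a))
    fun _ => rfl
  rw [abs_lt] at e1 e2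
  linarith

/-- Conditional entropies add up along an orbit. -/
lemma ent_orbit_le {A B : Type*} [Fintype A] [MeasurableSpace A] [MeasurableSingletonClass A]
    [Fintype B] [MeasurableSpace B] [MeasurableSingletonClass B]
    {T : X → X} (hT : MeasurePreserving T μ μ) {f : X → A} (hf : Measurable f)
    {g : X → B} (hg : Measurable g) (n : ℕ) :
    ent μ (fun x (i : Fin n) => f (T^[i] x)) ≤
      ent μ (fun x (i : Fin n) => g (T^[i] x)) + n * (ent μ (fun x => (f x, g x)) - ent μ g) := by
  have mF : ∀ n, Measurable (fun x (i : Fin n) => f (T^[i] x)) := fun n =>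
    measurable_pi_lambda _ fun i => hf.comp (hT.measurable.iterate i)
  have mG : ∀ n, Measurable (fun x (i : Fin n) => g (T^[i] x)) := fun n =>
    measurable_pi_lambda _ fun i => hg.comp (hT.measurable.iterate i)
  suffices H : ent μ (fun x => ((fun i : Fin n => f (T^[i] x)), (fun i : Fin n => g (T^[i] x)))) ≤
      ent μ (fun x (i : Fin n) => g (T^[i] x)) + n * (ent μ (fun x => (f x, g x)) - ent μ g) from
    (ent_le_of_eq_comp ((mF n).prodMk (mG n)) Prod.fst fun _ => rfl).trans H
  induction n with
  | zero =>
    simp only [CharP.cast_eq_zero, zero_mul, add_zero]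
    exact ent_le_of_eq_comp (mG 0) (fun v => (fun i => i.elim0, v))
      fun x => Prod.ext (Subsingleton.elim _ _) rfl
  | succ n ih =>
    have ma : Measurable (fun x => f (T^[n] x)) := hf.comp (hT.measurable.iterate n)
    have mb : Measurable (fun x => g (T^[n] x)) := hg.comp (hT.measurable.iterate n)
    have hTn := hT.iterate n
    have i1 : ent μ (fun x => (f (T^[n] x), g (T^[n] x))) = ent μ (fun x => (f x, g x)) :=
      ent_comp_measurePreserving (hf.prodMk hg) hTn
    have i2 : ent μ (fun x => g (T^[n] x)) = ent μ g := ent_comp_measurePreserving hg hTn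
    have s1 := ent_submodular (μ := μ) ((mF n).prodMk (mG n)) ma mb
    have s2 := ent_submodular (μ := μ) (mF n) mb (mG n)
    have c1 : ent μ (fun x => ((fun i : Fin (n + 1) => f (T^[i] x)),
        (fun i : Fin (n + 1) => g (T^[i] x)))) ≤ ent μ (fun x => (((fun i : Fin n => f (T^[i] x)),
        (fun i : Fin n => g (T^[i] x))), f (T^[n] x), g (T^[n] x))) :=
      ent_le_of_eq_comp (((mF n).prodMk (mG n)).prodMk (ma.prodMk mb))
        (fun v => (Fin.snoc (α := fun _ => A) v.1.1 v.2.1, Fin.snoc (α := fun _ => B) v.1.2 v.2.2))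
        fun x => by
          refine Prod.ext ?_ ?_ <;>
          · funext i
            refine Fin.lastCases ?_ (fun i => ?_) i <;> simp
    have c2 : ent μ (fun x => (((fun i : Fin n => f (T^[i] x)), (fun i : Fin n => g (T^[i] x))),
        g (T^[n] x))) ≤ ent μ (fun x => ((fun i : Fin n => f (T^[i] x)), g (T^[n] x),
        (fun i : Fin n => g (T^[i] x)))) :=
      ent_le_of_eq_comp ((mF n).prodMk (mb.prodMk (mG n))) (fun v => ((v.1, v.2.2), v.2.1))
        fun _ => rfl
    have c3 : ent μ (fun x => (g (T^[n] x), (fun i : Fin n => g (T^[i] x)))) ≤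
        ent μ (fun x (i : Fin (n + 1)) => g (T^[i] x)) :=
      ent_le_of_eq_comp (mG (n + 1)) (fun v => (v (Fin.last n), fun i => v i.castSucc))
        fun _ => rfl
    push_cast
    linarith

end

/-! ### Ergodic components of a power of an ergodic map -/

lemma eq_or_mutuallySingular_of_ergodic {X : Type*} [MeasurableSpace X] {f : X → X}
    {μ ν : Measure X} [IsProbabilityMeasure μ] [IsProbabilityMeasure ν]
    (hμ : Ergodic f μ) (hν : Ergodic f ν) : μ = ν ∨ μ ⟂ₘ ν := by
  set ρ := ν.withDensity (μ.rnDeriv ν) with hρ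
  have hinv : MeasurePreserving f ρ ρ :=
    hμ.toMeasurePreserving.withDensity_rnDeriv hν.toMeasurePreserving
  have hle : ρ ≤ μ := Measure.withDensity_rnDeriv_le μ ν
  have : IsFiniteMeasure ρ := ⟨(hle _).trans_lt (measure_lt_top μ _)⟩
  obtain ⟨c, hc⟩ := hν.eq_smul_of_absolutelyContinuous hinv (withDensity_absolutelyContinuous _ _)
  obtain ⟨c', hc'⟩ := hμ.eq_smul_of_absolutelyContinuous hinv
    (Measure.absolutelyContinuous_of_le hle)
  have h1 : c = c' := by
    have e1 := congrArg (fun m : Measure X => m Set.univ) hc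
    have e2 := congrArg (fun m : Measure X => m Set.univ) hc'
    simp only [Measure.smul_apply, measure_univ, smul_eq_mul, mul_one] at e1 e2
    exact e1.symm.trans e2
  by_cases h0 : c = 0
  · right
    rw [← Measure.withDensity_rnDeriv_eq_zero, ← hρ, hc, h0, zero_smul]
  · left
    have ht : c ≠ ∞ := by
      have e1 := congrArg (fun m : Measure X => m Set.univ) hc
      simp only [Measure.smul_apply, measure_univ, smul_eq_mul, mul_one] at e1
      rw [← e1]
      exact measure_ne_top _ _
    rw [← h1, hc] at hc'
    ext s _
    have := congrArg (fun m : Measure X => m s) hc'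
    simp only [Measure.smul_apply, smul_eq_mul] at this
    exact ((ENNReal.mul_right_inj h0 ht).1 this).symm

/-- A power of an ergodic map has an ergodic component, and the invariant measure is the average
of the translates of that component. -/
lemma exists_ergodic_component {X : Type*} [MeasurableSpace X] {S : X → X} {μ : Measure X}
    [IsProbabilityMeasure μ] (hS : Ergodic S μ) {M : ℕ} (hM : 0 < M) :
    ∃ μ₀ : Measure X, IsProbabilityMeasure μ₀ ∧ Ergodic S^[M] μ₀ ∧
      (M : ℝ≥0∞) • μ = Measure.sum fun i : Fin M => μ₀.map S^[i] := by
  have hSm := hS.measurable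
  -- invariant sets of positive measure have measure at least `1 / M`
  set I : Set (Set X) := {A | MeasurableSet A ∧ S^[M] ⁻¹' A = A ∧ μ A ≠ 0} with hI
  have hlow : ∀ A ∈ I, (M : ℝ)⁻¹ ≤ μ.real A := by
    rintro A ⟨hA, hinv, hpos⟩
    set U : Set X := ⋃ i ∈ Finset.range M, S^[i] ⁻¹' A with hU
    have hUm : MeasurableSet U :=
      Finset.measurableSet_biUnion _ fun i _ => hSm.iterate i hA
    have hUinv : S ⁻¹' U = U := by
      ext x
      simp only [hU, Set.mem_preimage, Set.mem_iUnion, Finset.mem_range, exists_prop,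
        ← Function.iterate_succ_apply]
      constructor
      · rintro ⟨i, hi, hx⟩
        rcases Nat.lt_or_ge (i + 1) M with h | h
        · exact ⟨i + 1, h, hx⟩
        · obtain rfl : M = i + 1 := by omega
          refine ⟨0, by omega, ?_⟩
          rw [← hinv]
          exact hx
      · rintro ⟨i, hi, hx⟩
        rcases Nat.eq_zero_or_pos i with rfl | h
        · refine ⟨M - 1, by omega, ?_⟩
          rw [Nat.succ_eq_add_one, Nat.sub_add_cancel hM]
          rw [← hinv] at hx
          exact hx
        · refine ⟨i - 1, by omega, ?_⟩
          rwa [Nat.succ_eq_add_one, Nat.sub_add_cancel h]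
    have hle : μ.real U ≤ M * μ.real A := by
      refine (measureReal_biUnion_finset_le _ _).trans_eq ?_
      simp [fun i => (hS.toMeasurePreserving.iterate i).measureReal_preimage hA.nullMeasurableSet]
    have hU1 : μ.real U = 1 := by
      have h0 : μ U ≠ 0 := fun h => hpos <| measure_mono_null
        (fun x hx => Set.mem_iUnion₂.2 ⟨0, Finset.mem_range.2 hM, hx⟩) h
      rcases hS.toPreErgodic.prob_eq_zero_or_one hUm hUinv with h | h
      · exact absurd h h0
      · simp [Measure.real, h]
    rw [hU1] at hle
    have : (0 : ℝ) < M := by exact_mod_cast hM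
    rwa [inv_le_iff_one_le_mul₀' this]
  have hM' : (0 : ℝ) < (M : ℝ)⁻¹ := by positivity
  -- a minimal such set
  set c := sInf (μ.real '' I) with hc
  have hne : (μ.real '' I).Nonempty := ⟨_, Set.univ, ⟨.univ, rfl, by simp⟩, rfl⟩
  have hbdd : BddBelow (μ.real '' I) := ⟨0, by rintro _ ⟨A, _, rfl⟩; exact measureReal_nonneg⟩
  have hcM : (M : ℝ)⁻¹ ≤ c := le_csInf hne (by rintro _ ⟨A, hA, rfl⟩; exact hlow A hA)
  obtain ⟨_, ⟨A, hAI, rfl⟩, hAc⟩ := exists_lt_of_csInf_lt hne (show c < c + c by linarith)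
  have hmem : ∀ B ∈ I, c ≤ μ.real B := fun B hB => csInf_le hbdd ⟨B, hB, rfl⟩
  obtain ⟨hA, hAinv, hApos⟩ := hAI
  set μ₀ := ProbabilityTheory.cond μ A with hμ₀
  have hprob : IsProbabilityMeasure μ₀ := ProbabilityTheory.cond_isProbabilityMeasure hApos
  have hac : μ₀ ≪ μ := ProbabilityTheory.cond_absolutelyContinuous
  have hQ := hS.toMeasurePreserving.iterate M
  have hpres : MeasurePreserving S^[M] μ₀ μ₀ := by
    refine MeasurePreserving.smul_measure ?_ _
    have := hQ.restrict_preimage hA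
    rwa [hAinv] at this
  have herg : Ergodic S^[M] μ₀ := by
    refine ⟨hpres, ⟨fun s hs hinv => ?_⟩⟩
    rw [eventuallyConst_set']
    by_cases h1 : μ (A ∩ s) = 0
    · left
      rw [ae_eq_empty, hμ₀, ProbabilityTheory.cond_apply hA, h1, mul_zero]
    · by_cases h2 : μ (A ∩ sᶜ) = 0
      · right
        rw [ae_eq_univ, hμ₀, ProbabilityTheory.cond_apply hA, h2, mul_zero]
      · exfalso
        have e1 := hmem _ ⟨hA.inter hs, by rw [Set.preimage_inter, hAinv, hinv], h1⟩
        have e2 := hmem _ ⟨hA.inter hs.compl,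
          by rw [Set.preimage_inter, Set.preimage_compl, hAinv, hinv], h2⟩
        have e3 := measureReal_inter_add_sdiff (μ := μ) (s := A) hs
        rw [Set.sdiff_eq] at e3
        linarith
  refine ⟨μ₀, hprob, herg, ?_⟩
  rw [Measure.sum_fintype, Fin.sum_univ_eq_sum_range (fun i => μ₀.map S^[i])]
  set ν := ∑ i ∈ Finset.range M, μ₀.map S^[i] with hν
  have hprobi : ∀ i, IsProbabilityMeasure (μ₀.map S^[i]) := fun i =>
    Measure.isProbabilityMeasure_map (hSm.iterate i).aemeasurable
  have huniv : ν Set.univ = M := by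
    simp [hν, Measure.finsetSum_apply]
  have hfin : IsFiniteMeasure ν := ⟨by rw [huniv]; exact ENNReal.natCast_lt_top _⟩
  have hνS : MeasurePreserving S ν ν := by
    refine ⟨hSm, ?_⟩
    rw [hν, Measure.map_finset_sum hSm.aemeasurable]
    have : ∀ i, (μ₀.map S^[i]).map S = μ₀.map S^[i + 1] := fun i => by
      rw [Measure.map_map hSm (hSm.iterate i), Function.iterate_succ']
    simp only [this]
    have h0 : μ₀.map S^[M] = μ₀.map S^[0] := by
      rw [hpres.map_eq, Function.iterate_zero, Measure.map_id]
    obtain ⟨m, rfl⟩ : ∃ m, M = m + 1 := ⟨M - 1, by omega⟩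
    rw [Finset.sum_range_succ, Finset.sum_range_succ', h0]
  have hνac : ν ≪ μ := by
    rw [hν]
    refine Measure.AbsolutelyContinuous.mk fun s hs h => ?_
    rw [Measure.finsetSum_apply, Finset.sum_eq_zero]
    intro i _
    rw [Measure.map_apply (hSm.iterate i) hs]
    apply hac
    rw [(hS.toMeasurePreserving.iterate i).measure_preimage hs.nullMeasurableSet, h]
  obtain ⟨d, hd⟩ := hS.eq_smul_of_absolutelyContinuous hνS hνac
  have : d = M := by
    have e := congrArg (fun m : Measure X => m Set.univ) hd
    simpa [huniv] using e.symm
  rw [hd, this]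

/-- If `F` commutes with an ergodic automorphism `S`, preserves the measure and is invariant under
a map `T` commuting with `S^[M]`, then either `T` moves the measure to a singular one, or `T`
preserves an ergodic component of `S^[M]`. -/
theorem exists_component_map_eq {X : Type*} [MeasurableSpace X] {S : X ≃ᵐ X} {F T : X → X}
    {μ : Measure X} [IsProbabilityMeasure μ] (hS : Ergodic S μ) (hF : MeasurePreserving F μ μ)
    (hT : Measurable T) (hFS : Function.Commute F S) {M : ℕ} (hM : 0 < M)
    (hTS : Function.Commute T S^[M]) (hFT : ∀ x, F (T x) = F x) (hns : ¬ μ.map T ⟂ₘ μ) :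
    ∃ μ₀ : Measure X, (M : ℝ≥0∞) • μ = Measure.sum (fun i : Fin M => μ₀.map S^[i]) ∧
      μ₀.map T = μ₀ := by
  obtain ⟨μ₀, hprob, herg, hsum⟩ := exists_ergodic_component hS hM
  have hSm : ∀ i, Measurable S^[i] := fun i => S.measurable.iterate i
  have hFm := hF.measurable
  have hM0 : (M : ℝ≥0∞) ≠ 0 := by exact_mod_cast hM.ne'
  have hac : μ ≪ Measure.sum fun i : Fin M => μ₀.map S^[i] := by
    rw [← hsum]
    exact Measure.absolutelyContinuous_smul hM0
  have hac' : (Measure.sum fun i : Fin M => μ₀.map S^[i]) ≪ μ := by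
    rw [← hsum]
    exact Measure.smul_absolutelyContinuous
  have hprobi : ∀ i, IsProbabilityMeasure (μ₀.map S^[i]) := fun i =>
    Measure.isProbabilityMeasure_map (hSm i).aemeasurable
  have hergi : ∀ i, Ergodic S^[M] (μ₀.map S^[i]) := fun i =>
    MeasurePreserving.ergodic_of_ergodic_semiconj ⟨hSm i, rfl⟩ herg (hSm M)
      (Function.Commute.iterate_iterate_self _ _ _)
  -- `T` maps some component to a component
  obtain ⟨i, j, hij⟩ : ∃ i j : Fin M, (μ₀.map S^[i]).map T = μ₀.map S^[j] := by
    by_contra! H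
    refine hns (Measure.MutuallySingular.mono_ac ?_ (hac.map hT) hac)
    rw [Measure.map_sum hT.aemeasurable, Measure.MutuallySingular.sum_left]
    intro i
    rw [Measure.MutuallySingular.sum_right]
    intro j
    have := Measure.isProbabilityMeasure_map (μ := μ₀.map S^[i]) hT.aemeasurable
    have hTe : Ergodic S^[M] ((μ₀.map S^[i]).map T) :=
      MeasurePreserving.ergodic_of_ergodic_semiconj ⟨hT, rfl⟩ (hergi i) (hSm M) hTS
    exact (eq_or_mutuallySingular_of_ergodic hTe (hergi j)).resolve_left (H i j)
  -- `F` acts on the components as a power of `S`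
  obtain ⟨k, hk⟩ : ∃ k : Fin M, μ₀.map F = μ₀.map S^[k] := by
    by_contra! H
    have := Measure.isProbabilityMeasure_map (μ := μ₀) hFm.aemeasurable
    have hFe : Ergodic S^[M] (μ₀.map F) :=
      MeasurePreserving.ergodic_of_ergodic_semiconj ⟨hFm, rfl⟩ herg (hSm M) (hFS.iterate_right M)
    have hsing : μ₀.map F ⟂ₘ Measure.sum fun i : Fin M => μ₀.map S^[i] :=
      Measure.MutuallySingular.sum_right.2 fun j =>
        (eq_or_mutuallySingular_of_ergodic hFe (hergi j)).resolve_left (H j)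
    have h0 : μ₀ ≪ μ := by
      refine Measure.AbsolutelyContinuous.trans ?_ hac'
      refine Measure.absolutelyContinuous_of_le ?_
      have := Measure.le_sum (fun i : Fin M => μ₀.map S^[i]) ⟨0, hM⟩
      simpa using this
    have h1 : μ₀.map F ≪ μ := by
      have := h0.map hFm
      rwa [hF.map_eq] at this
    have := Measure.eq_zero_of_absolutelyContinuous_of_mutuallySingular (h1.trans hac) hsing
    exact (IsProbabilityMeasure.ne_zero (μ₀.map F)) this
  have hFi : ∀ i : ℕ, (μ₀.map S^[i]).map F = (μ₀.map S^[i]).map S^[(k : ℕ)] := fun i => by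
    rw [Measure.map_map hFm (hSm i), (hFS.iterate_right i).comp_eq,
      ← Measure.map_map (hSm i) hFm, hk, Measure.map_map (hSm i) (hSm k),
      Measure.map_map (hSm k) (hSm i), ← Function.iterate_add, ← Function.iterate_add, add_comm]
  have hSinj : ∀ n : ℕ, ∀ ν ν' : Measure X, ν.map S^[n] = ν'.map S^[n] → ν = ν' := by
    intro n
    induction n with
    | zero => intro ν ν' h; simpa using h
    | succ n ih =>
      intro ν ν' h
      rw [Function.iterate_succ, ← Measure.map_map (hSm n) S.measurable,
        ← Measure.map_map (hSm n) S.measurable] at h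
      exact S.map_measurableEquiv_injective (ih _ _ h)
  have hFij : (μ₀.map S^[i]).map F = (μ₀.map S^[j]).map F := by
    rw [← hij, Measure.map_map hFm hT]
    congr 1
    exact (funext hFT).symm
  rw [hFi, hFi] at hFij
  refine ⟨μ₀.map S^[i], ?_, by rw [hij]; exact (hSinj _ _ _ hFij).symm⟩
  have : ((M : ℝ≥0∞) • μ).map S^[i] = (M : ℝ≥0∞) • μ := by
    rw [Measure.map_smul, (hS.toMeasurePreserving.iterate i).map_eq]
  rw [← this, hsum, Measure.map_sum (hSm i).aemeasurable]
  congr 1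
  ext1 l
  rw [Measure.map_map (hSm i) (hSm l), Measure.map_map (hSm l) (hSm i), ← Function.iterate_add,
    ← Function.iterate_add, add_comm]

/-! ### Windows and vanishing entropy -/

section

variable {G : Type*}

/-- The word of `x` at coordinates `0, …, n - 1`. -/
def res (n : ℕ) (x : ℤ → G) : Fin n → G := fun i => x (i : ℕ)

lemma cyl_eq_preimage_res {n : ℕ} (w : Fin n → G) : cyl w = res n ⁻¹' {w} := by
  ext x
  exact ⟨fun h => funext h, fun h => congrFun h⟩

lemma shiftMap_iterate (k : ℕ) (x : ℤ → G) (n : ℤ) : shiftMap^[k] x n = x (n + k) := by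
  induction k generalizing x with
  | zero => simp
  | succ k ih =>
    rw [Function.iterate_succ_apply, ih, shiftMap]
    congr 1
    push_cast
    ring

lemma CA_iterate_congr (φ : G → G → G) (i : ℕ) {x y : ℤ → G} {a b : ℤ}
    (h : ∀ j, a ≤ j → j < b + i → x j = y j) :
    ∀ j, a ≤ j → j < b → (CA φ)^[i] x j = (CA φ)^[i] y j := by
  induction i generalizing x y with
  | zero => simpa using h
  | succ i ih =>
    refine ih (x := CA φ x) (y := CA φ y) fun j h1 h2 => ?_
    push_cast at h
    rw [CA, CA, h j h1 (by lia), h (j + 1) (by lia) (by lia)]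

variable [MeasurableSpace G]

lemma measurable_res (n : ℕ) : Measurable (res n : (ℤ → G) → Fin n → G) :=
  measurable_pi_lambda _ fun _ => measurable_pi_apply _

lemma measurable_shiftMap : Measurable (shiftMap : (ℤ → G) → ℤ → G) :=
  measurable_pi_lambda _ fun _ => measurable_pi_apply _

variable (G) in
/-- The shift as a measurable automorphism. -/
def shiftEquiv : (ℤ → G) ≃ᵐ (ℤ → G) where
  toFun := shiftMap
  invFun x n := x (n - 1)
  left_inv x := by ext n; simp [shiftMap]
  right_inv x := by ext n; simp [shiftMap]
  measurable_toFun := measurable_shiftMap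
  measurable_invFun := measurable_pi_lambda _ fun _ => measurable_pi_apply _

lemma shiftEquiv_symm_iterate (k : ℕ) (x : ℤ → G) (n : ℤ) :
    (shiftEquiv G).symm^[k] x n = x (n - k) := by
  induction k generalizing x with
  | zero => simp
  | succ k ih =>
    rw [Function.iterate_succ_apply, ih]
    change x (n - k - 1) = _
    congr 1
    push_cast
    ring

/-- Every finite-valued measurable function is approximated by functions of a finite window. -/
lemma exists_window_approx {A : Type*} [Fintype A] [Nonempty A] [MeasurableSpace A]
    [MeasurableSingletonClass A] {κ : Measure (ℤ → G)} [IsFiniteMeasure κ] {f : (ℤ → G) → A}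
    (hf : Measurable f) {ε : ℝ} (hε : 0 < ε) :
    ∃ (k n : ℕ) (ψ : (Fin n → G) → A),
      κ.real {x | ψ (res n ((shiftEquiv G).symm^[k] x)) ≠ f x} < ε := by
  classical
  have hd := Measure.MeasureDense.of_generateFrom_isSetAlgebra_finite κ
    (isSetAlgebra_measurableCylinders (α := fun _ : ℤ => G)) generateFrom_measurableCylinders.symm
  have hN : (0 : ℝ) < Fintype.card A := by exact_mod_cast Fintype.card_pos
  choose t ht hlt using fun a => hd.approx (f ⁻¹' {a}) (hf (measurableSet_singleton a))
    (measure_ne_top _ _) (ε / Fintype.card A) (div_pos hε hN)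
  choose s S _ hts using fun a => (mem_measurableCylinders _).1 (ht a)
  obtain ⟨k, hk⟩ : ∃ k : ℕ, ∀ a, ∀ j ∈ s a, j.natAbs < k := by
    refine ⟨(Finset.univ.biUnion s).sup Int.natAbs + 1, fun a j hj => Nat.lt_succ_of_le ?_⟩
    exact Finset.le_sup (f := Int.natAbs) (Finset.mem_biUnion.2 ⟨a, Finset.mem_univ _, hj⟩)
  let g : (ℤ → G) → A := fun x => Classical.epsilon fun a => x ∈ t a
  have hg : Function.FactorsThrough g
      (fun x : ℤ → G => res (2 * k) ((shiftEquiv G).symm^[k] x)) := by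
    intro x y hxy
    refine congrArg Classical.epsilon (funext fun a => propext ?_)
    rw [hts, mem_cylinder, mem_cylinder]
    suffices (s a).restrict x = (s a).restrict y by rw [this]
    ext ⟨j, hj⟩
    have hj' := hk a j hj
    have := congrFun hxy ⟨(j + k).toNat, by omega⟩
    simp only [res, shiftEquiv_symm_iterate] at this
    rwa [show (((j + k).toNat : ℕ) : ℤ) - k = j by omega] at this
  obtain ⟨ψ, hψ⟩ := (Function.factorsThrough_iff g).1 hg
  refine ⟨k, 2 * k, ψ, ?_⟩
  have hsub : {x | ψ (res (2 * k) ((shiftEquiv G).symm^[k] x)) ≠ f x} ⊆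
      ⋃ a ∈ (Finset.univ : Finset A), symmDiff (f ⁻¹' {a}) (t a) := by
    intro x hx
    by_contra hc
    simp only [Finset.mem_univ, Set.iUnion_true, Set.mem_iUnion, not_exists,
      Set.mem_symmDiff] at hc
    have hiff : ∀ a, x ∈ t a ↔ f x = a := by
      intro a
      have := hc a
      simp only [Set.mem_preimage, Set.mem_singleton_iff] at this
      tauto
    refine hx ((congrFun hψ x).symm.trans ?_)
    exact ((hiff _).1 (Classical.epsilon_spec (p := fun a => x ∈ t a) ⟨f x, (hiff _).2 rfl⟩)).symm
  calc κ.real {x | ψ (res (2 * k) ((shiftEquiv G).symm^[k] x)) ≠ f x}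
      ≤ κ.real (⋃ a ∈ (Finset.univ : Finset A), symmDiff (f ⁻¹' {a}) (t a)) :=
        measureReal_mono hsub (measure_ne_top _ _)
    _ ≤ ∑ a, κ.real (symmDiff (f ⁻¹' {a}) (t a)) := measureReal_biUnion_finset_le _ _
    _ < ∑ _a : A, ε / Fintype.card A := by
        refine Finset.sum_lt_sum_of_nonempty Finset.univ_nonempty fun a _ => ?_
        exact ENNReal.toReal_lt_of_lt_ofReal (hlt a)
    _ = ε := by
        rw [Finset.sum_const, Finset.card_univ, nsmul_eq_mul]
        field_simp

end

lemma ent_le_of_forall_eq {X A B : Type*} [MeasurableSpace X] [Nonempty X] {μ : Measure X}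
    [IsFiniteMeasure μ] [Fintype A] [Fintype B] [MeasurableSpace A] [MeasurableSingletonClass A]
    {f : X → A} (hf : Measurable f) {g : X → B} (h : ∀ x y, f x = f y → g x = g y) :
    ent μ g ≤ ent μ f := by
  have : Nonempty B := Nonempty.map g ‹_›
  obtain ⟨e, he⟩ := (Function.factorsThrough_iff g).1 (fun x y => h x y : g.FactorsThrough f)
  exact ent_le_of_eq_comp hf e (congrFun he)

lemma joinEntropy_eq_ent {X : Type*} [MeasurableSpace X] (μ : Measure X) (T : X → X) {r : ℕ}
    {P : Fin r → Set X} {f : X → Fin r} (hf : ∀ x i, x ∈ P i ↔ f x = i) (n : ℕ) :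
    joinEntropy μ T P n = ent μ (fun x (i : Fin n) => f (T^[i] x)) := by
  have : ∀ c : Fin n → Fin r, (⋂ i : Fin n, T^[(i : ℕ)] ⁻¹' P (c i)) =
      (fun x (i : Fin n) => f (T^[i] x)) ⁻¹' {c} := by
    intro c
    ext x
    simp [hf, funext_iff]
  simp only [joinEntropy, ent, this, Real.negMulLog, neg_mul, Finset.sum_neg_distrib, Measure.real]

section

variable {G : Type*} [Fintype G] [MeasurableSpace G] [MeasurableSingletonClass G]
  {φ : G → G → G} {μ : Measure (ℤ → G)} [IsProbabilityMeasure μ]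

/-- The entropy of long words grows slowly when `x₀` is almost a function of finitely many
coordinates of the image of `x`. -/
lemma ent_res_add_le (hΦ : MeasurePreserving (CA φ) μ μ) (hinj : ∀ a, Function.Injective (φ a))
    (h : ∀ ε > 0, ∃ (m : ℕ) (g : (Fin m → G) → G), μ.real {x | g (res m (CA φ x)) ≠ x 0} < ε)
    {δ : ℝ} (hδ : 0 < δ) :
    ∃ m : ℕ, ∀ n : ℕ, ent μ (res (G := G) (m + n)) ≤ ent μ (res (G := G) m) + n * δ := by
  have : Nonempty (ℤ → G) := nonempty_of_isProbabilityMeasure μ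
  have mf : Measurable fun x : ℤ → G => x 0 := measurable_pi_apply 0
  obtain ⟨ε, hε, hent⟩ := exists_ent_pair_sub_lt (μ := μ) mf hδ
  obtain ⟨m, g, hg⟩ := h ε hε
  have mR : ∀ n, Measurable fun x : ℤ → G => res n (CA φ x) := fun n =>
    (measurable_res n).comp hΦ.measurable
  have mk : Measurable fun x : ℤ → G => g (res m (CA φ x)) :=
    (measurable_of_finite g).comp (mR m)
  have hlt := hent _ mk hg
  have step : ∀ n, m ≤ n → ent μ (res (G := G) (n + 1)) ≤ ent μ (res (G := G) n) + δ := by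
    intro n hn
    have sub := ent_submodular (μ := μ) mf (mR n) mk
    have e1 : ent μ (fun x : ℤ → G => (res n (CA φ x), g (res m (CA φ x)))) ≤
        ent μ (res (G := G) n) := by
      rw [← ent_comp_measurePreserving (measurable_res n) hΦ]
      refine ent_le_of_forall_eq (mR n) fun x y hxy =>
        Prod.ext hxy (congrArg g (funext fun i => ?_))
      exact congrFun hxy ⟨i, i.2.trans_le hn⟩
    have e2 : ent μ (res (G := G) (n + 1)) ≤
        ent μ (fun x : ℤ → G => (x 0, res n (CA φ x), g (res m (CA φ x)))) := by
      refine ent_le_of_forall_eq (mf.prodMk ((mR n).prodMk mk)) fun x y hxy => ?_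
      simp only [Prod.mk.injEq] at hxy
      obtain ⟨h0, hres, -⟩ := hxy
      have : ∀ i : ℕ, i < n + 1 → x i = y i := by
        intro i
        induction i with
        | zero => intro _; exact h0
        | succ i ih =>
          intro hi
          have hi' := congrFun hres ⟨i, by omega⟩
          simp only [res, CA, ih (by omega)] at hi'
          exact_mod_cast hinj _ hi'
      exact funext fun i => this i i.2
    linarith
  refine ⟨m, fun n => ?_⟩
  induction n with
  | zero => simp
  | succ n ih =>
    have := step (m + n) (by omega)
    rw [← add_assoc]
    push_cast
    linarith

/-- The entropy of `CA φ` vanishes when `x₀` is almost a function of finitely many coordinates of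
the image of `x`. -/
lemma not_KSEntropyPos (hS : MeasurePreserving shiftMap μ μ) (hΦ : MeasurePreserving (CA φ) μ μ)
    (hinj : ∀ a, Function.Injective (φ a))
    (h : ∀ ε > 0, ∃ (m : ℕ) (g : (Fin m → G) → G), μ.real {x | g (res m (CA φ x)) ≠ x 0} < ε) :
    ¬ KSEntropyPos μ (CA φ) := by
  rintro ⟨r, P, hPm, hPd, hPu, hpos⟩
  have : Nonempty (ℤ → G) := nonempty_of_isProbabilityMeasure μ
  have hex : ∀ x, ∃ i, x ∈ P i := fun x => Set.mem_iUnion.1 (hPu ▸ Set.mem_univ x)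
  choose f hf using hex
  have hfP : ∀ x i, x ∈ P i ↔ f x = i := fun x i =>
    ⟨fun hx => by_contra fun hne => Set.disjoint_left.1 (hPd hne) (hf x) hx, fun hx => hx ▸ hf x⟩
  have : Nonempty (Fin r) := Nonempty.map f ‹_›
  have mf : Measurable f := measurable_to_countable' fun i => by
    convert hPm i using 1
    ext x
    exact (hfP x i).symm
  simp only [joinEntropy_eq_ent μ (CA φ) hfP] at hpos
  set L := liminf (fun n : ℕ => ent μ (fun x (i : Fin n) => f ((CA φ)^[i] x)) / n) atTop
  have hδ : 0 < L / 4 := by linarith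
  obtain ⟨ε, hε, hent⟩ := exists_ent_pair_sub_lt (μ := μ) mf hδ
  obtain ⟨k, l, ψ, hψ⟩ := exists_window_approx (κ := μ) mf hε
  obtain ⟨m, hm⟩ := ent_res_add_le hΦ hinj h hδ
  have hSk : MeasurePreserving (shiftEquiv G).symm^[k] μ μ :=
    ((show MeasurePreserving (shiftEquiv G) μ μ from hS).symm).iterate k
  have mw : ∀ n, Measurable fun x : ℤ → G => res n ((shiftEquiv G).symm^[k] x) := fun n =>
    (measurable_res n).comp hSk.measurable
  have mg : Measurable fun x : ℤ → G => ψ (res l ((shiftEquiv G).symm^[k] x)) :=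
    (measurable_of_finite ψ).comp (mw l)
  have hlt := hent _ mg hψ
  have bound : ∀ n : ℕ, ent μ (fun x (i : Fin n) => f ((CA φ)^[i] x)) ≤
      ent μ (res (G := G) m) + (l + n) * (L / 4) + n * (L / 4) := by
    intro n
    have h1 := ent_orbit_le hΦ mf mg n
    have h2 : ent μ (fun x (i : Fin n) => ψ (res l ((shiftEquiv G).symm^[k] ((CA φ)^[i] x)))) ≤
        ent μ (res (G := G) (m + (l + n))) := by
      rw [← ent_comp_measurePreserving (measurable_res (m + (l + n))) hSk]
      refine ent_le_of_forall_eq (mw _) fun x y hxy => funext fun i => congrArg ψ ?_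
      ext j
      simp only [res, shiftEquiv_symm_iterate]
      refine CA_iterate_congr φ i (a := -k) (b := l - k) (fun t h1 h2 => ?_) _ (by omega)
        (by omega)
      have := congrFun hxy ⟨(t + k).toNat, by omega⟩
      simp only [res, shiftEquiv_symm_iterate] at this
      rwa [show (((t + k).toNat : ℕ) : ℤ) - k = t by omega] at this
    have h3 := hm (l + n)
    have h4 : (n : ℝ) * (ent μ (fun x => (f x, ψ (res l ((shiftEquiv G).symm^[k] x)))) -
        ent μ (fun x => ψ (res l ((shiftEquiv G).symm^[k] x)))) ≤ n * (L / 4) :=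
      mul_le_mul_of_nonneg_left hlt.le (Nat.cast_nonneg n)
    push_cast at h3
    linarith
  have hle : L ≤ 3 * (L / 4) := by
    refine liminf_le_of_frequently_le (Eventually.frequently ?_) ?_
    · obtain ⟨N, hN⟩ := exists_nat_gt ((ent μ (res (G := G) m) + l * (L / 4)) / (L / 4))
      rw [div_lt_iff₀ hδ] at hN
      filter_upwards [eventually_ge_atTop (N + 1)] with n hn
      have hn' : (N : ℝ) + 1 ≤ n := by exact_mod_cast hn
      rw [div_le_iff₀ (by linarith [(Nat.cast_nonneg N : (0 : ℝ) ≤ N)])]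
      have := bound n
      nlinarith
    · refine isBoundedUnder_of ⟨0, fun n => div_nonneg (Finset.sum_nonneg fun a _ => ?_)
        (Nat.cast_nonneg n)⟩
      exact Real.negMulLog_nonneg measureReal_nonneg measureReal_le_one
  linarith

end

/-! ### Words of a topological Markov chain -/

/-- The word `w` only uses allowed transitions. -/
def IsPath {G : Type*} (E : Set (G × G)) {n : ℕ} (w : Fin n → G) : Prop :=
  ∀ (i : ℕ) (h : i + 1 < n), (w ⟨i, by omega⟩, w ⟨i + 1, h⟩) ∈ E

section

variable {G : Type*} {E : Set (G × G)}

lemma isPath_res {x : ℤ → G} (hx : x ∈ TMC E) (n : ℕ) : IsPath E (res n x) := fun i _ => by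
  simpa [res] using hx i

lemma isPath_cons {n : ℕ} (a : G) (w : Fin (n + 1) → G) :
    IsPath E (Fin.cons a w : Fin (n + 2) → G) ↔ (a, w 0) ∈ E ∧ IsPath E w := by
  constructor
  · intro h
    exact ⟨by simpa using h 0 (by omega), fun i hi => h (i + 1) (by omega)⟩
  · rintro ⟨h0, h⟩ (_ | i) hi
    · exact h0
    · exact h i (by omega)

lemma WordIn.isPath {n : ℕ} {w : Fin n → G} (h : WordIn (TMC E) w) : IsPath E w := by
  obtain ⟨x, hx, j, hj⟩ := h
  intro i hi
  have := hx (j + i)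
  rw [add_assoc] at this
  have h1 := hj ⟨i, by omega⟩
  have h2 := hj ⟨i + 1, hi⟩
  push_cast at h1 h2
  rwa [h1, h2] at this

lemma IsPath.wordIn (hE : EveryLetterOccurs E) {n : ℕ} {w : Fin (n + 1) → G} (h : IsPath E w) :
    WordIn (TMC E) w := by
  obtain ⟨x, hx, i, hi⟩ := hE (w 0)
  obtain ⟨y, hy, j, hj⟩ := hE (w (Fin.last n))
  refine ⟨fun k => if k < 0 then x (i + k) else if hk : k.toNat < n + 1 then w ⟨k.toNat, hk⟩
    else y (j + (k - n)), fun k => ?_, 0, fun k => ?_⟩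
  · rcases lt_trichotomy k (-1) with hk | rfl | hk
    · have := hx (i + k)
      beta_reduce
      rw [if_pos (by omega), if_pos (by omega)]
      rwa [add_assoc] at this
    · have := hx (i + -1)
      simpa [hi] using this
    · obtain ⟨k, rfl⟩ := Int.eq_ofNat_of_zero_le (show 0 ≤ k by omega)
      beta_reduce
      rw [if_neg (by omega), if_neg (by omega)]
      rcases lt_trichotomy k n with hk | rfl | hk
      · rw [dif_pos (by omega), dif_pos (by omega)]
        exact h k (by omega)
      · have := hy j
        rw [dif_pos (by omega), dif_neg (by omega)]
        rw [hj] at this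
        convert this using 3
        · simp [Fin.last]
        · omega
      · have := hy (j + (k - n))
        rw [dif_neg (by omega), dif_neg (by omega)]
        convert this using 3
        ring
  · have := k.2
    beta_reduce
    rw [if_neg (by omega), dif_pos (by omega)]
    simp

lemma sum_fin_succ {G M : Type*} [Fintype G] [AddCommMonoid M] {n : ℕ}
    (f : (Fin (n + 1) → G) → M) : ∑ w, f w = ∑ w : Fin n → G, ∑ a, f (Fin.cons a w) := by
  rw [← (Fin.consEquiv fun _ : Fin (n + 1) => G).sum_comp, Fintype.sum_prod_type,
    Finset.sum_comm]
  rfl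

lemma sum_indicator_one {α : Type*} [Fintype α] (s : Set α) :
    ∑ a, s.indicator (fun _ => (1 : ℝ)) a = s.ncard := by
  classical
  simp [Set.indicator_apply, Finset.sum_boole, Set.ncard_eq_toFinset_card', Set.toFinset]

end

/-- If every letter has `q` predecessors, the number of words grows like `q ^ m`. -/
lemma ncard_isPath {G : Type*} [Fintype G] {E : Set (G × G)} {q : ℕ}
    (hq : ∀ b, {a | (a, b) ∈ E}.ncard = q) (m : ℕ) :
    ({w : Fin (m + 1) → G | IsPath E w}.ncard : ℝ) = Fintype.card G * q ^ m := by
  induction m with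
  | zero =>
    have : {w : Fin (0 + 1) → G | IsPath E w} = Set.univ :=
      Set.eq_univ_of_forall fun w i hi => by omega
    rw [this, Set.ncard_univ, Nat.card_eq_fintype_card]
    simp
  | succ m ih =>
    rw [← sum_indicator_one, sum_fin_succ]
    have : ∀ w : Fin (m + 1) → G, (∑ a, {w : Fin (m + 1 + 1) → G | IsPath E w}.indicator
        (fun _ => (1 : ℝ)) (Fin.cons a w)) =
        {w : Fin (m + 1) → G | IsPath E w}.indicator (fun _ => (1 : ℝ)) w * q := by
      intro w
      classical
      rw [← hq (w 0), ← sum_indicator_one, Finset.mul_sum]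
      refine Finset.sum_congr rfl fun a _ => ?_
      simp only [Set.indicator_apply, Set.mem_ofPred_eq, isPath_cons]
      split_ifs <;> simp_all
    rw [Finset.sum_congr rfl fun w _ => this w, ← Finset.sum_mul, sum_indicator_one, ih, pow_succ]
    ring

lemma eq_of_tendsto_log_ncard {G : Type*} [Fintype G] [Nonempty G] {E : Set (G × G)}
    (hE : EveryLetterOccurs E) {q p : ℕ} (hq0 : 0 < q) (hp : 0 < p)
    (hq : ∀ b, {a | (a, b) ∈ E}.ncard = q)
    (hent : Tendsto (fun m : ℕ => Real.log ({w : Fin m → G | WordIn (TMC E) w}.ncard) / m)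
      atTop (nhds (Real.log p))) : q = p := by
  have h1 := hent.comp (tendsto_add_atTop_nat 1)
  have h2 : Tendsto (fun m : ℕ => (Real.log (Fintype.card G) - Real.log q) * ((m + 1 : ℕ) : ℝ)⁻¹
      + Real.log q) atTop (nhds ((Real.log (Fintype.card G) - Real.log q) * 0 + Real.log q)) :=
    ((((tendsto_inv_atTop_nhds_zero_nat (𝕜 := ℝ)).comp (tendsto_add_atTop_nat 1)).const_mul
      _).add_const _)
  have hq' : (q : ℝ) ≠ 0 := by exact_mod_cast hq0.ne'
  have hlog : Real.log q = Real.log p := by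
    rw [mul_zero, zero_add] at h2
    refine tendsto_nhds_unique (h2.congr fun m => ?_) h1
    have hset : {w : Fin (m + 1) → G | WordIn (TMC E) w} = {w | IsPath E w} :=
      Set.ext fun w => ⟨WordIn.isPath, IsPath.wordIn hE⟩
    have hG : (Fintype.card G : ℝ) ≠ 0 := by exact_mod_cast Fintype.card_ne_zero
    simp only [Function.comp_apply]
    rw [hset, ncard_isPath hq, Real.log_mul hG (pow_ne_zero _ hq'), Real.log_pow]
    push_cast
    field_simp
    ring
  have := Real.log_injOn_pos (Set.mem_Ioi.2 (by exact_mod_cast hq0))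
    (Set.mem_Ioi.2 (by exact_mod_cast hp)) hlog
  exact_mod_cast this

lemma surjOn_of_injective {α β : Type*} [Finite β] {F : α → β} (hF : F.Injective) {s : Set α}
    {t : Set β} (hm : Set.MapsTo F s t) (hc : t.ncard ≤ s.ncard) : Set.SurjOn F s t :=
  (Set.eq_of_subset_of_ncard_le hm.image_subset (by rwa [Set.ncard_image_of_injective _ hF])
    (Set.toFinite _)).ge

/-! ### Sets closed under an affine operation -/

/-- In a finite abelian group, a set closed under `A x + B y + c` is a coset of a subgroup which is
invariant under `A` and `B`. -/
lemma exists_addSubgroup_of_affine_closed {K : Type*} [AddCommGroup K] [Finite K] {E : Set K}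
    (hne : E.Nonempty) (A B : K ≃+ K) (c : K) (h : ∀ e ∈ E, ∀ f ∈ E, A e + B f + c ∈ E) :
    ∃ H : AddSubgroup K, (∀ e ∈ E, ∀ k, k ∈ E ↔ k - e ∈ H) ∧ (∀ k, A k ∈ H ↔ k ∈ H) ∧
      ∀ k, B k ∈ H ↔ k ∈ H := by
  have surj : ∀ F : K → K, F.Injective → Set.MapsTo F E E → ∀ u ∈ E, ∃ e ∈ E, F e = u :=
    fun F hF hm => surjOn_of_injective hF hm le_rfl
  let H : AddSubgroup K :=
    { carrier := {k | ∀ e, e + k ∈ E ↔ e ∈ E}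
      zero_mem' := fun e => by rw [add_zero]
      add_mem' := fun {k l} hk hl e => by rw [← add_assoc, hl, hk]
      neg_mem' := fun {k} hk e => by rw [← hk, neg_add_cancel_right] }
  have memH : ∀ k, (∀ e ∈ E, e + k ∈ E) → k ∈ H := by
    intro k hk e
    refine ⟨fun he => ?_, hk e⟩
    obtain ⟨e', he', heq⟩ := surj (· + k) (add_left_injective k) hk _ he
    rwa [← add_right_cancel heq]
  have hB : ∀ f ∈ E, ∀ f' ∈ E, B (f' - f) ∈ H := by
    intro f hf f' hf'
    refine memH _ fun u hu => ?_
    obtain ⟨e, he, rfl⟩ := surj (fun e => A e + B f + c) (fun e e' hee => by simpa using hee)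
      (fun e he => h e he f hf) u hu
    convert h e he f' hf' using 1
    rw [map_sub]
    abel
  have hA : ∀ f ∈ E, ∀ f' ∈ E, A (f' - f) ∈ H := by
    intro f hf f' hf'
    refine memH _ fun u hu => ?_
    obtain ⟨e, he, rfl⟩ := surj (fun e => A f + B e + c) (fun e e' hee => by simpa using hee)
      (fun e he => h f hf e he) u hu
    convert h f' hf' e he using 1
    rw [map_sub]
    abel
  have key : ∀ e ∈ E, ∀ k, k ∈ E ↔ k - e ∈ H := by
    intro e he
    have hsub : (H : Set K) ⊆ (· - e) '' E := fun k hk =>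
      ⟨e + k, (hk e).2 he, by simp⟩
    have heq : (H : Set K) = (· - e) '' E := by
      refine Set.eq_of_subset_of_ncard_le hsub ?_ (Set.toFinite _)
      rw [← Set.ncard_image_of_injective _ B.injective]
      refine Set.ncard_le_ncard ?_ (Set.toFinite _)
      rintro _ ⟨_, ⟨f, hf, rfl⟩, rfl⟩
      exact hB e he f hf
    intro k
    rw [← SetLike.mem_coe, heq]
    constructor
    · exact fun hk => ⟨k, hk, rfl⟩
    · rintro ⟨f, hf, hfk⟩
      rwa [← sub_left_injective hfk]
  obtain ⟨e, he⟩ := hne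
  have inv : ∀ F : K ≃+ K, (∀ f ∈ E, ∀ f' ∈ E, F (f' - f) ∈ H) → ∀ k, F k ∈ H ↔ k ∈ H := by
    intro F hF
    have hm : ∀ k ∈ H, F k ∈ H := fun k hk => by
      simpa using hF e he (e + k) ((hk e).2 he)
    refine fun k => ⟨fun hk => ?_, hm k⟩
    obtain ⟨l, hl, hlk⟩ := surjOn_of_injective (s := (H : Set K)) (t := H) F.injective hm
      le_rfl hk
    rwa [← F.injective hlk]
  exact ⟨H, key, inv A hA, inv B hB⟩

/-- `D` parametrizes the fibres of the local rule `φ` on allowed transitions: transitions with the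
same image differ by `(g, θ g)` with `g ∈ D`. -/
structure IsFibreGroup {G : Type*} [AddCommGroup G] (E : Set (G × G)) (φ : G → G → G)
    (θ : AddAut G) (D : AddSubgroup G) : Prop where
  rule_add : ∀ a b g, φ (a + g) (b + θ g) = φ a b
  theta_mem : ∀ g ∈ D, θ g ∈ D
  edge_add : ∀ g ∈ D, ∀ a b, (a, b) ∈ E → (a + g, b + θ g) ∈ E
  eq_add : ∀ a b a' b', (a, b) ∈ E → (a', b') ∈ E → φ a b = φ a' b' →
    ∃ g ∈ D, a' = a + g ∧ b' = b + θ g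

/-- The fibre group of an SC affine rule; its order is the number of successors of any letter. -/
lemma exists_isFibreGroup {G : Type*} [Fintype G] [AddCommGroup G] {E : Set (G × G)}
    (hE : EveryLetterOccurs E) (hirr : IrreducibleTMC E) {φ : G → G → G} (hSC : SC E φ)
    (η ρ : G ≃+ G) (c : G) (hφ : ∀ a b, φ a b = η a + ρ b + c) :
    ∃ (θ : AddAut G) (D : AddSubgroup G), IsFibreGroup E φ θ D ∧
      (∀ a, {b | (a, b) ∈ E}.ncard = Nat.card D) ∧ (∀ b, {a | (a, b) ∈ E}.ncard = Nat.card D) := by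
  have hsucc : ∀ a, ∃ b, (a, b) ∈ E := fun a => by
    obtain ⟨x, hx, i, rfl⟩ := hE a
    exact ⟨_, hx i⟩
  have hpred : ∀ b, ∃ a, (a, b) ∈ E := fun b => by
    obtain ⟨x, hx, i, rfl⟩ := hE b
    exact ⟨x (i - 1), by simpa using hx (i - 1)⟩
  have hpt : ∀ a b, (a, b) ∈ E → ∃ x ∈ TMC E, x 0 = a ∧ x 1 = b := by
    intro a b hab
    have hp : IsPath E ![a, b] := by
      intro i hi
      obtain rfl : i = 0 := by omega
      exact hab
    obtain ⟨x, hx, j, hj⟩ := hp.wordIn hE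
    refine ⟨fun i => x (j + i), fun i => ?_, by simpa using hj 0, by simpa using hj 1⟩
    simpa [add_assoc] using hx (j + i)
  have hedge : ∀ a b a' b', (a, b) ∈ E → (a', b') ∈ E → (φ a a', φ b b') ∈ E := by
    intro a b a' b' h h'
    obtain ⟨x, hx, rfl, rfl⟩ := hpt a b h
    obtain ⟨y, hy, rfl, rfl⟩ := hpt a' b' h'
    exact hSC x hx y hy 0
  obtain ⟨b₀, hb₀⟩ := hsucc 0
  obtain ⟨H, hH, hηH, hρH⟩ := exists_addSubgroup_of_affine_closed (E := E) ⟨_, hb₀⟩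
    (AddEquiv.prodCongr η η) (AddEquiv.prodCongr ρ ρ) (c, c) (by
      rintro ⟨a, b⟩ h ⟨a', b'⟩ h'
      have := hedge a b a' b' h h'
      rwa [hφ, hφ] at this)
  let θ : AddAut G := (η.trans ρ.symm).trans (AddEquiv.neg G)
  have hθ : ∀ g, η g + ρ (θ g) = 0 := fun g => by simp [θ]
  have hθ' : ∀ g k, η g + ρ k = 0 → k = θ g := fun g k h => by
    rw [← hθ g] at h
    exact ρ.injective (add_left_cancel h)
  let D : AddSubgroup G := H.comap ((AddMonoidHom.id G).prod θ.toAddMonoidHom)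
  have memD : ∀ g, g ∈ D ↔ (g, θ g) ∈ H := fun g => Iff.rfl
  have isFib : IsFibreGroup E φ θ D := by
    refine ⟨fun a b g => ?_, fun g hg => ?_, fun g hg a b hab => ?_, fun a b a' b' h h' heq => ?_⟩
    · rw [hφ, hφ, map_add, map_add, add_add_add_comm, hθ, add_zero]
    · rw [memD] at hg ⊢
      rw [← hρH, ← neg_mem_iff]
      convert (hηH _).2 hg using 1
      exact Prod.ext (neg_eq_of_add_eq_zero_left (hθ g)) (neg_eq_of_add_eq_zero_left (hθ _))
    · rw [hH _ hab]
      simpa using (memD g).1 hg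
    · rw [hφ, hφ, add_left_inj] at heq
      have e : b' - b = θ (a' - a) := by
        refine hθ' _ _ ?_
        rw [map_sub, map_sub, sub_add_sub_comm, heq, sub_self]
      refine ⟨a' - a, ?_, by abel, by rw [← e]; abel⟩
      rw [memD, ← e]
      exact (hH _ h _).1 h'
  have cardS : ∀ a, {b | (a, b) ∈ E}.ncard = {h | ((0, h) : G × G) ∈ H}.ncard := by
    intro a
    obtain ⟨b, hb⟩ := hsucc a
    symm
    rw [← Set.ncard_image_of_injective _ (add_right_injective b)]
    congr 1
    ext b'
    change _ ↔ (a, b') ∈ E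
    rw [hH _ hb, Prod.mk_sub_mk, sub_self]
    exact ⟨by rintro ⟨k, hk, rfl⟩; simpa using hk, fun h => ⟨_, h, by simp⟩⟩
  have cardP : ∀ b, {a | (a, b) ∈ E}.ncard = {h | ((h, 0) : G × G) ∈ H}.ncard := by
    intro b
    obtain ⟨a, ha⟩ := hpred b
    symm
    rw [← Set.ncard_image_of_injective _ (add_right_injective a)]
    congr 1
    ext a'
    change _ ↔ (a', b) ∈ E
    rw [hH _ ha, Prod.mk_sub_mk, sub_self]
    exact ⟨by rintro ⟨k, hk, rfl⟩; simpa using hk, fun h => ⟨_, h, by simp⟩⟩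
  -- the local rule maps the transitions onto the alphabet
  have hsurj : ∀ v, ∃ a b, (a, b) ∈ E ∧ φ a b = v := by
    have step : ∀ u v, (∃ a b, (a, b) ∈ E ∧ φ a b = u) → (u, v) ∈ E →
        ∃ a b, (a, b) ∈ E ∧ φ a b = v := by
      rintro _ v ⟨a, b, hab, rfl⟩ hv
      obtain ⟨b', hb', rfl⟩ := surjOn_of_injective (F := φ b) (s := {b' | (b, b') ∈ E})
        (t := {v | (φ a b, v) ∈ E}) (fun x y hxy => by simpa [hφ] using hxy)
        (fun b' hb' => hedge _ _ _ _ hab hb') (by rw [cardS, cardS]) hv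
      exact ⟨b, b', hb', rfl⟩
    intro v
    obtain ⟨x, hx, i, j, hij, hi, rfl⟩ := hirr (φ 0 b₀) v
    have : ∀ n : ℕ, ∃ a b, (a, b) ∈ E ∧ φ a b = x (i + n) := by
      intro n
      induction n with
      | zero => exact ⟨0, b₀, hb₀, by simp [hi]⟩
      | succ n ih =>
        refine step _ _ ih ?_
        have := hx (i + n)
        rwa [add_assoc] at this
    rw [show j = i + (j - i).toNat by omega]
    exact this _
  have cardE : E.ncard = Fintype.card G * {h | ((0, h) : G × G) ∈ H}.ncard := by
    have : (E.ncard : ℝ) = Fintype.card G * {h | ((0, h) : G × G) ∈ H}.ncard := by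
      rw [← sum_indicator_one, Fintype.sum_prod_type]
      have : ∀ a, ∑ b, E.indicator (fun _ => (1 : ℝ)) (a, b) =
          {h | ((0, h) : G × G) ∈ H}.ncard := fun a => by
        rw [← cardS a, ← sum_indicator_one]
        rfl
      simp [this]
    exact_mod_cast this
  have cardE' : E.ncard = Fintype.card G * {h | ((h, 0) : G × G) ∈ H}.ncard := by
    have : (E.ncard : ℝ) = Fintype.card G * {h | ((h, 0) : G × G) ∈ H}.ncard := by
      rw [← sum_indicator_one, Fintype.sum_prod_type, Finset.sum_comm]
      have : ∀ b, ∑ a, E.indicator (fun _ => (1 : ℝ)) (a, b) =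
          {h | ((h, 0) : G × G) ∈ H}.ncard := fun b => by
        rw [← cardP b, ← sum_indicator_one]
        rfl
      simp [this]
    exact_mod_cast this
  have cardD : E.ncard = Fintype.card G * Nat.card D := by
    choose s t hst hstv using hsurj
    have e : G × D ≃ E := Equiv.ofBijective
      (fun q => ⟨(s q.1 + q.2, t q.1 + θ q.2), isFib.edge_add _ q.2.2 _ _ (hst _)⟩) (by
        constructor
        · rintro ⟨v, g⟩ ⟨v', g'⟩ h
          simp only [Subtype.mk.injEq, Prod.mk.injEq] at h
          have hv : v = v' := by
            rw [← hstv v, ← hstv v', ← isFib.rule_add (s v) (t v) g,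
              ← isFib.rule_add (s v') (t v') g', h.1, h.2]
          subst hv
          exact Prod.ext rfl (Subtype.ext (add_left_cancel h.1))
        · rintro ⟨⟨a, b⟩, hab⟩
          obtain ⟨g, hg, h1, h2⟩ := isFib.eq_add _ _ a b (hst (φ a b)) hab (hstv _)
          exact ⟨(φ a b, ⟨g, hg⟩), Subtype.ext (Prod.ext h1.symm h2.symm)⟩)
    rw [← Nat.card_coe_set_eq, ← Nat.card_congr e, Nat.card_prod, Nat.card_eq_fintype_card]
  have hG : 0 < Fintype.card G := Fintype.card_pos
  refine ⟨θ, D, isFib, fun a => ?_, fun b => ?_⟩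
  · rw [cardS]
    exact Nat.eq_of_mul_eq_mul_left hG (cardE.symm.trans cardD)
  · rw [cardP]
    exact Nat.eq_of_mul_eq_mul_left hG (cardE'.symm.trans cardD)

/-! ### Translations along the fibres -/

section

variable {G : Type*} [AddCommGroup G]

/-- The point whose coordinates are the images of `g` under the powers of `θ`. -/
def orbitPoint (θ : AddAut G) (g : G) : ℤ → G := fun i => (i • θ) g

lemma orbitPoint_zero_right (θ : AddAut G) : orbitPoint θ 0 = 0 := funext fun _ => map_zero _

lemma orbitPoint_apply_zero (θ : AddAut G) (g : G) : orbitPoint θ g 0 = g := by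
  simp [orbitPoint]

lemma orbitPoint_succ (θ : AddAut G) (g : G) (i : ℤ) :
    orbitPoint θ g (i + 1) = θ (orbitPoint θ g i) := by
  rw [orbitPoint, add_comm, one_add_zsmul]
  rfl

lemma orbitPoint_add_right (θ : AddAut G) (g h : G) :
    orbitPoint θ (g + h) = orbitPoint θ g + orbitPoint θ h := funext fun _ => map_add _ _ _

lemma orbitPoint_zsmul (θ : AddAut G) (g : G) (i k : ℤ) :
    orbitPoint θ ((k • θ) g) i = orbitPoint θ g (i + k) := by
  rw [orbitPoint, orbitPoint, add_zsmul]
  rfl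

/-- Translation by `orbitPoint θ g`. -/
def translate (θ : AddAut G) (g : G) (x : ℤ → G) : ℤ → G := x + orbitPoint θ g

lemma translate_zero (θ : AddAut G) : translate θ (0 : G) = id :=
  funext fun x => by rw [translate, orbitPoint_zero_right, add_zero, id]

lemma translate_add (θ : AddAut G) (g h : G) :
    translate θ (g + h) = translate θ g ∘ translate θ h := by
  funext x
  simp only [translate, Function.comp_apply, orbitPoint_add_right]
  abel

lemma shiftMap_iterate_translate (θ : AddAut G) (g : G) (k : ℕ) (x : ℤ → G) :
    shiftMap^[k] (translate θ g x) = translate θ (((k : ℤ) • θ) g) (shiftMap^[k] x) := by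
  ext n
  simp only [translate, shiftMap_iterate, Pi.add_apply, orbitPoint_zsmul]

namespace IsFibreGroup

variable {E : Set (G × G)} {φ : G → G → G} {θ : AddAut G} {D : AddSubgroup G}

lemma CA_translate (h : IsFibreGroup E φ θ D) (g : G) (x : ℤ → G) :
    CA φ (translate θ g x) = CA φ x := by
  ext i
  simp only [CA, translate, Pi.add_apply, orbitPoint_succ]
  exact h.rule_add _ _ _

lemma zsmul_mem [Finite G] (h : IsFibreGroup E φ θ D) {g : G} (hg : g ∈ D) (i : ℤ) :
    (i • θ) g ∈ D := by
  have hn : ∀ n : ℕ, (n • θ) g ∈ D := by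
    intro n
    induction n with
    | zero => simpa using hg
    | succ n ih =>
      rw [succ_nsmul']
      exact h.theta_mem _ ih
  rw [← mod_addOrderOf_zsmul]
  have : 0 < addOrderOf θ := addOrderOf_pos θ
  lift i % (addOrderOf θ : ℤ) to ℕ using Int.emod_nonneg _ (by omega) with n
  rw [natCast_zsmul]
  exact hn n

/-- Two words with the same image differ by a word of some `orbitPoint`. -/
lemma exists_eq_add (h : IsFibreGroup E φ θ D) {n : ℕ} {w w' : Fin (n + 2) → G}
    (hw : IsPath E w) (hw' : IsPath E w')
    (heq : ∀ i : Fin (n + 1), φ (w i.castSucc) (w i.succ) = φ (w' i.castSucc) (w' i.succ)) :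
    ∃ g ∈ D, w' = w + res (n + 2) (orbitPoint θ g) := by
  have key : ∀ (i : ℕ) (hi : i + 1 < n + 2), ∃ g ∈ D, w' ⟨i, by omega⟩ = w ⟨i, by omega⟩ + g ∧
      w' ⟨i + 1, hi⟩ = w ⟨i + 1, hi⟩ + θ g := fun i hi =>
    h.eq_add _ _ _ _ (hw i hi) (hw' i hi) (heq ⟨i, by omega⟩)
  obtain ⟨g, hg, h0, -⟩ := key 0 (by omega)
  have step : ∀ (i : ℕ) (hi : i < n + 2), w' ⟨i, hi⟩ = w ⟨i, hi⟩ + orbitPoint θ g i := by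
    intro i
    induction i with
    | zero => intro _; rw [h0]; simp [orbitPoint_apply_zero]
    | succ i ih =>
      intro hi
      obtain ⟨g', -, h1, h2⟩ := key i hi
      rw [ih (by omega), add_right_inj] at h1
      rw [h2, ← h1, Nat.cast_succ, orbitPoint_succ]
  exact ⟨g, hg, funext fun i => step i i.2⟩

end IsFibreGroup

end

lemma measurableSet_TMC {G : Type*} [Finite G] [MeasurableSpace G] [MeasurableSingletonClass G]
    (E : Set (G × G)) : MeasurableSet (TMC E) := by
  have : TMC E = ⋂ i : ℤ, (fun x : ℤ → G => (x i, x (i + 1))) ⁻¹' E := by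
    ext x
    simp [TMC]
  rw [this]
  exact MeasurableSet.iInter fun i =>
    ((measurable_pi_apply i).prodMk (measurable_pi_apply (i + 1))) E.toFinite.measurableSet

lemma measureReal_le_of_ae {X : Type*} [MeasurableSpace X] {μ : Measure X} [IsFiniteMeasure μ]
    {s t : Set X} (h : ∀ᵐ x ∂μ, x ∈ s → x ∈ t) : μ.real s ≤ μ.real t :=
  ENNReal.toReal_mono (measure_ne_top _ _) (measure_mono_ae h)

lemma measurable_translate {G : Type*} [AddCommGroup G] [Finite G] [MeasurableSpace G]
    [MeasurableSingletonClass G] (θ : AddAut G) (g : G) : Measurable (translate θ g) :=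
  measurable_pi_lambda _ fun i =>
    (measurable_of_finite fun a : G => a + orbitPoint θ g i).comp (measurable_pi_apply i)

section

variable {G : Type*} [AddCommGroup G] [Fintype G] [MeasurableSpace G]
  [MeasurableSingletonClass G] {E : Set (G × G)} {φ : G → G → G} {θ : AddAut G}
  {D : AddSubgroup G} {μ : Measure (ℤ → G)} [IsProbabilityMeasure μ]

lemma IsFibreGroup.map_translate_eq_of_not_mutuallySingular (h : IsFibreGroup E φ θ D)
    (hS : Ergodic (shiftEquiv G) μ) (hΦ : MeasurePreserving (CA φ) μ μ) {p : ℕ} (hp : p.Prime)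
    (hD : Nat.card D = p) {g : G} (hg : g ∈ D) (hg0 : g ≠ 0)
    (hns : ¬ μ.map (translate θ g) ⟂ₘ μ) {g' : G} (hg' : g' ∈ D) :
    μ.map (translate θ g') = μ := by
  have mT := fun g => measurable_translate (G := G) θ g
  have hM : 0 < addOrderOf θ := addOrderOf_pos θ
  have hFS : Function.Commute (CA φ) (shiftEquiv G) := fun x => rfl
  obtain ⟨μ₀, hsum, hμ₀⟩ := exists_component_map_eq hS hΦ (mT g) hFS hM (fun x => by
      refine Eq.symm ((shiftMap_iterate_translate θ g _ x).trans ?_)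
      rw [natCast_zsmul, addOrderOf_nsmul_eq_zero]
      rfl) (h.CA_translate g) hns
  have hinv : ∀ k ∈ D, μ₀.map (translate θ k) = μ₀ := by
    have hmul : ∀ n : ℕ, μ₀.map (translate θ (n • g)) = μ₀ := by
      intro n
      induction n with
      | zero => rw [zero_smul, translate_zero, Measure.map_id]
      | succ n ih =>
        rw [succ_nsmul, translate_add, ← Measure.map_map (mT _) (mT _), hμ₀, ih]
    intro k hk
    have : Fact p.Prime := ⟨hp⟩
    obtain ⟨n, hn⟩ := mem_multiples_of_prime_card hD (g := (⟨g, hg⟩ : D)) (g' := ⟨k, hk⟩)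
      (fun h0 => hg0 (congrArg Subtype.val h0))
    rw [← show n • g = k from congrArg Subtype.val hn]
    exact hmul n
  have hM0 : (addOrderOf θ : ℝ≥0∞) ≠ 0 := by exact_mod_cast hM.ne'
  have hmap : ((addOrderOf θ : ℝ≥0∞) • μ).map (translate θ g') = (addOrderOf θ : ℝ≥0∞) • μ := by
    rw [hsum, Measure.map_sum (mT g').aemeasurable]
    congr 1
    ext1 i
    have mS : Measurable (shiftEquiv G)^[i] := (shiftEquiv G).measurable.iterate _
    have hcomm : translate θ g' ∘ (shiftEquiv G)^[i] =
        (shiftEquiv G)^[i] ∘ translate θ ((-(i : ℤ) • θ) g') := by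
      funext x
      refine Eq.symm ((shiftMap_iterate_translate θ _ i x).trans ?_)
      have : ((i : ℤ) • θ) ((-(i : ℤ) • θ) g') = g' := by
        rw [← AddAut.add_apply, ← add_zsmul, add_neg_cancel, zero_zsmul]
        rfl
      rw [this]
      rfl
    rw [Measure.map_map (mT g') mS, hcomm, ← Measure.map_map mS (mT _),
      hinv _ (h.zsmul_mem hg' _)]
  rw [Measure.map_smul] at hmap
  ext s hs
  have := congrArg (fun ν : Measure (ℤ → G) => ν s) hmap
  simp only [Measure.smul_apply, smul_eq_mul] at this
  exact (ENNReal.mul_right_inj hM0 (ENNReal.natCast_ne_top _)).1 this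

/-- If all fibre translates of `μ` are singular to `μ`, a point is almost determined by its
image. -/
lemma IsFibreGroup.exists_decoder (h : IsFibreGroup E φ θ D) (hμE : μ (TMC E) = 1)
    (hS : MeasurePreserving (shiftEquiv G) μ μ)
    (hsing : ∀ g ∈ D, g ≠ 0 → μ.map (translate θ g) ⟂ₘ μ) {ε : ℝ} (hε : 0 < ε) :
    ∃ (m : ℕ) (f : (Fin m → G) → G), μ.real {x | f (res m (CA φ x)) ≠ x 0} < ε := by
  classical
  have mT := fun g => measurable_translate (G := G) θ g
  have hD0 : (0 : ℝ) < Fintype.card D := by exact_mod_cast Fintype.card_pos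
  choose s hs hs1 hs2 using hsing
  set B : Set (ℤ → G) := ⋂ (g : D) (hg : (g : G) ≠ 0), s g g.2 hg with hB
  have mB : MeasurableSet B := MeasurableSet.iInter fun g => MeasurableSet.iInter fun hg => hs _ _ _
  have hB1 : ∀ᵐ x ∂μ, x ∈ B := by
    simp only [hB, Set.mem_iInter]
    refine ae_all_iff.2 fun g => ae_all_iff.2 fun hg => ?_
    exact mem_ae_iff.2 (hs2 g g.2 hg)
  have hB2 : ∀ g ∈ D, g ≠ 0 → ∀ᵐ x ∂μ, translate θ g x ∉ B := by
    intro g hg hg0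
    have : ∀ᵐ x ∂(μ.map (translate θ g)), x ∉ B := by
      rw [ae_iff]
      refine measure_mono_null (fun x hx => ?_) (hs1 g hg hg0)
      rw [Set.mem_ofPred_eq, not_not] at hx
      exact Set.mem_iInter₂.1 hx ⟨g, hg⟩ hg0
    exact ae_of_ae_map (mT g).aemeasurable this
  let κ : Measure (ℤ → G) := ∑ g : D, μ.map (translate θ g)
  have : IsFiniteMeasure κ := by
    have := fun g : D => Measure.isProbabilityMeasure_map (μ := μ) (mT g).aemeasurable
    infer_instance
  obtain ⟨k, n, ψ, hψ⟩ := exists_window_approx (κ := κ) (f := fun x => x ∈ B) mB.mem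
    (div_pos hε hD0)
  have mψ : ∀ j, Measurable fun x : ℤ → G => ψ (res n ((shiftEquiv G).symm^[j] x)) := fun j =>
    (measurable_of_finite ψ).comp
      ((measurable_res n).comp ((shiftEquiv G).symm.measurable.iterate j))
  have hκ : ∀ g ∈ D, μ.real {x | ψ (res n ((shiftEquiv G).symm^[k] (translate θ g x))) ≠
      (translate θ g x ∈ B)} < ε / Fintype.card D := by
    intro g hg
    refine lt_of_le_of_lt ?_ hψ
    have mset : MeasurableSet {x | ψ (res n ((shiftEquiv G).symm^[k] x)) ≠ (x ∈ B)} :=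
      (measurableSet_eq_fun (mψ k) mB.mem).compl
    refine ENNReal.toReal_mono (measure_ne_top _ _) ?_
    change μ (translate θ g ⁻¹' {x | ψ (res n ((shiftEquiv G).symm^[k] x)) ≠ (x ∈ B)}) ≤ _
    rw [← Measure.map_apply (mT g) mset]
    exact Finset.single_le_sum (f := fun g : D => μ.map (translate θ g))
      (fun _ _ => Measure.zero_le _) (Finset.mem_univ (⟨g, hg⟩ : D)) _
  have hbad : ∀ g : D, μ.real {x | ψ (res n (translate θ g x)) ↔ (g : G) ≠ 0} <
      ε / Fintype.card D := by
    intro g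
    have hSk : MeasurePreserving (shiftEquiv G).symm^[k] μ μ := hS.symm.iterate k
    have mset : MeasurableSet {x | ψ (res n (translate θ g x)) ↔ (g : G) ≠ 0} := by
      have : Measurable fun x => ψ (res n (translate θ g x)) := (mψ 0).comp (mT g)
      exact (measurable_of_finite fun P : Prop => (P ↔ (g : G) ≠ 0)).comp this |>.setOf
    rw [← hSk.measureReal_preimage mset.nullMeasurableSet]
    have hg' := h.zsmul_mem g.2 k
    have h0 : ((k : ℤ) • θ) (g : G) = 0 ↔ (g : G) = 0 := EmbeddingLike.map_eq_zero_iff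
    refine lt_of_le_of_lt (measureReal_le_of_ae ?_) (hκ _ hg')
    have hae : ∀ᵐ x ∂μ, translate θ (((k : ℤ) • θ) g) x ∈ B ↔ (g : G) = 0 := by
      by_cases hg0 : (g : G) = 0
      · filter_upwards [hB1] with x hx
        simpa [hg0, translate_zero] using hx
      · filter_upwards [hB2 _ hg' (mt h0.1 hg0)] with x hx
        simpa [hg0] using hx
    filter_upwards [hae] with x hx hx2
    have hcom : (shiftEquiv G).symm^[k] (translate θ (((k : ℤ) • θ) g) x) =
        translate θ g ((shiftEquiv G).symm^[k] x) := by
      ext i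
      simp only [shiftEquiv_symm_iterate, translate, Pi.add_apply, orbitPoint_zsmul,
        sub_add_cancel]
    change ψ (res n (translate θ g ((shiftEquiv G).symm^[k] x))) ↔ (g : G) ≠ 0 at hx2
    change ψ _ ≠ _
    rw [hcom]
    simp only [ne_eq, eq_iff_iff, hx, hx2]
    tauto
  let C : Set (Fin (n + 2) → G) := {w | IsPath E w ∧ ψ fun i => w ⟨i, by omega⟩}
  let f : (Fin (n + 1) → G) → G := fun y => Classical.epsilon
    (fun w => w ∈ C ∧ ∀ i, φ (w i.castSucc) (w i.succ) = y i) 0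
  refine ⟨n + 1, f, ?_⟩
  have hsub : ∀ᵐ x ∂μ, f (res (n + 1) (CA φ x)) ≠ x 0 →
      x ∈ ⋃ g ∈ (Finset.univ : Finset D), {x | ψ (res n (translate θ g x)) ↔ (g : G) ≠ 0} := by
    have hE' : ∀ᵐ x ∂μ, x ∈ TMC E := (prob_compl_eq_zero_iff (measurableSet_TMC E)).2 hμE
    filter_upwards [hE'] with x hx
    contrapose!
    intro hx2
    simp only [Finset.mem_univ, Set.iUnion_true, Set.mem_iUnion, not_exists,
      Set.mem_ofPred_eq] at hx2
    have hψx : ψ (res n x) := by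
      have := hx2 0
      simpa [translate_zero] using this
    have hmem : res (n + 2) x ∈ C ∧ ∀ i, φ (res (n + 2) x i.castSucc) (res (n + 2) x i.succ) =
        res (n + 1) (CA φ x) i := by
      refine ⟨⟨isPath_res hx _, hψx⟩, fun i => ?_⟩
      simp [res, CA]
    obtain ⟨⟨hp, hpψ⟩, himg⟩ := Classical.epsilon_spec (p := fun w : Fin (n + 2) → G =>
      w ∈ C ∧ ∀ i, φ (w i.castSucc) (w i.succ) = res (n + 1) (CA φ x) i) ⟨_, hmem⟩
    obtain ⟨g, hg, hw⟩ := h.exists_eq_add hmem.1.1 hp fun i => (hmem.2 i).trans (himg i).symm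
    have hg0 : g = 0 := by
      by_contra hg0
      refine hx2 ⟨g, hg⟩ ⟨fun _ => hg0, fun _ => ?_⟩
      rw [hw] at hpψ
      exact hpψ
    change Classical.epsilon (p := fun w : Fin (n + 2) → G =>
      w ∈ C ∧ ∀ i, φ (w i.castSucc) (w i.succ) = res (n + 1) (CA φ x) i) 0 = x 0
    rw [hw, hg0, orbitPoint_zero_right]
    simp [res]
  calc μ.real {x | f (res (n + 1) (CA φ x)) ≠ x 0}
      ≤ μ.real (⋃ g ∈ (Finset.univ : Finset D),
          {x | ψ (res n (translate θ g x)) ↔ (g : G) ≠ 0}) := measureReal_le_of_ae hsub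
    _ ≤ ∑ g : D, μ.real {x | ψ (res n (translate θ g x)) ↔ (g : G) ≠ 0} :=
        measureReal_biUnion_finset_le _ _
    _ < ∑ _g : D, ε / Fintype.card D :=
        Finset.sum_lt_sum_of_nonempty Finset.univ_nonempty fun g _ => hbad g
    _ = ε := by
        rw [Finset.sum_const, Finset.card_univ, nsmul_eq_mul]
        field_simp

end

/-! ### Measures invariant under the fibre translations -/

/-- The image of a word under a local rule. -/
def wordImage {G : Type*} (φ : G → G → G) {n : ℕ} (w : Fin (n + 1) → G) : Fin n → G :=
  fun i => φ (w i.castSucc) (w i.succ)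

lemma res_CA {G : Type*} (φ : G → G → G) (n : ℕ) (x : ℤ → G) :
    res n (CA φ x) = wordImage φ (res (n + 1) x) := by
  ext i
  simp [res, CA, wordImage]

lemma mem_cyl_cons {G : Type*} {n : ℕ} {a : G} {w : Fin n → G} {x : ℤ → G} :
    x ∈ cyl (Fin.cons a w : Fin (n + 1) → G) ↔ x 0 = a ∧ shiftMap x ∈ cyl w := by
  change (∀ i : Fin (n + 1), _) ↔ _
  rw [Fin.forall_fin_succ]
  simp [cyl, shiftMap]

lemma measurableSet_cyl {G : Type*} [MeasurableSpace G] [MeasurableSingletonClass G]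
    {n : ℕ} (w : Fin n → G) : MeasurableSet (cyl w) := by
  rw [cyl_eq_preimage_res]
  exact measurable_res n (measurableSet_singleton w)

lemma measureReal_cyl_add {G : Type*} [MeasurableSpace G] [MeasurableSingletonClass G]
    [Finite G] [AddCommGroup G] {μ : Measure (ℤ → G)} {θ : AddAut G} {g : G}
    (hg : μ.map (translate θ g) = μ) {n : ℕ} (w : Fin n → G) :
    μ.real (cyl (w + res n (orbitPoint θ g))) = μ.real (cyl w) := by
  have hT : MeasurePreserving (translate θ g) μ μ := ⟨measurable_translate θ g, hg⟩
  rw [← hT.measureReal_preimage (measurableSet_cyl _).nullMeasurableSet]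
  congr 1
  ext x
  simp [cyl, translate, res]

section

variable {G : Type*} [Fintype G] [MeasurableSpace G] [MeasurableSingletonClass G]
  {E : Set (G × G)} {μ : Measure (ℤ → G)}

lemma sum_measureReal_cyl_cons [IsFiniteMeasure μ] (hS : MeasurePreserving shiftMap μ μ) {n : ℕ}
    (w : Fin n → G) : ∑ a, μ.real (cyl (Fin.cons a w : Fin (n + 1) → G)) = μ.real (cyl w) := by
  rw [← hS.measureReal_preimage (measurableSet_cyl w).nullMeasurableSet,
    measureReal_preimage_eq_sum (measurable_pi_apply (0 : ℤ)) _
      (hS.measurable (measurableSet_cyl w))]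
  refine Finset.sum_congr rfl fun a _ => congrArg _ (Set.ext fun x => ?_)
  exact mem_cyl_cons

variable [IsProbabilityMeasure μ]

lemma measureReal_cyl_of_not_isPath (hμE : μ (TMC E) = 1) {n : ℕ} {w : Fin n → G}
    (hw : ¬ IsPath E w) : μ.real (cyl w) = 0 := by
  have hE' : ∀ᵐ x ∂μ, x ∈ TMC E := (prob_compl_eq_zero_iff (measurableSet_TMC E)).2 hμE
  refine le_antisymm ?_ measureReal_nonneg
  rw [← measureReal_empty (μ := μ)]
  refine measureReal_le_of_ae ?_
  filter_upwards [hE'] with x hx hxw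
  rw [cyl_eq_preimage_res] at hxw
  exact hw (hxw ▸ isPath_res hx n)

lemma measureReal_cyl_eq_sum {φ : G → G → G} [DecidableEq G]
    (hΦ : MeasurePreserving (CA φ) μ μ) {n : ℕ} (v : Fin n → G) :
    μ.real (cyl v) =
      ∑ w : Fin (n + 1) → G with wordImage φ w = v, μ.real (cyl w) := by
  rw [← hΦ.measureReal_preimage (measurableSet_cyl v).nullMeasurableSet,
    measureReal_preimage_eq_sum (measurable_res (n + 1)) _ (hΦ.measurable (measurableSet_cyl v)),
    Finset.sum_filter]
  refine Finset.sum_congr rfl fun w _ => ?_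
  have : CA φ ⁻¹' cyl v = {x | wordImage φ (res (n + 1) x) = v} := by
    ext x
    rw [cyl_eq_preimage_res]
    exact (congrArg (· = v) (res_CA φ n x)).to_iff
  rw [this, cyl_eq_preimage_res]
  split_ifs with hw
  · congr 1
    refine Set.inter_eq_left.2 fun x hx => ?_
    rw [Set.mem_preimage, Set.mem_singleton_iff] at hx
    rwa [Set.mem_ofPred_eq, hx]
  · rw [← measureReal_empty (μ := μ)]
    congr 1
    refine Set.eq_empty_of_forall_notMem fun x hx => hw ?_
    exact (congrArg _ (show res (n + 1) x = w from hx.1)).symm.trans hx.2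

variable [AddCommGroup G] {φ : G → G → G} {θ : AddAut G} {D : AddSubgroup G}

lemma IsFibreGroup.measureReal_cyl_wordImage (h : IsFibreGroup E φ θ D) (hμE : μ (TMC E) = 1)
    (hΦ : MeasurePreserving (CA φ) μ μ) (hinv : ∀ g ∈ D, μ.map (translate θ g) = μ) {n : ℕ}
    {w : Fin (n + 2) → G} (hw : IsPath E w) :
    μ.real (cyl (wordImage φ w)) = Nat.card D * μ.real (cyl w) := by
  classical
  rw [measureReal_cyl_eq_sum hΦ]
  have hsub : Finset.univ.image (fun g : D => w + res (n + 2) (orbitPoint θ (g : G))) ⊆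
      Finset.univ.filter fun w' => wordImage φ w' = wordImage φ w := by
    intro w' hw'
    obtain ⟨g, -, rfl⟩ := Finset.mem_image.1 hw'
    refine Finset.mem_filter.2 ⟨Finset.mem_univ _, funext fun i => ?_⟩
    simp only [wordImage, Pi.add_apply, res, Fin.val_castSucc, Fin.val_succ, Nat.cast_succ,
      orbitPoint_succ]
    exact h.rule_add _ _ _
  rw [← Finset.sum_subset hsub, Finset.sum_image]
  · simp [measureReal_cyl_add (hinv _ (Subtype.prop _))]
  · intro g _ g' _ hgg
    have := congrFun hgg 0
    simpa [res, orbitPoint_apply_zero] using this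
  · intro w' hw' hn
    refine measureReal_cyl_of_not_isPath hμE fun hp => hn ?_
    obtain ⟨g, hg, rfl⟩ := h.exists_eq_add hw hp fun i =>
      (congrFun (Finset.mem_filter.1 hw').2 i).symm
    exact Finset.mem_image.2 ⟨⟨g, hg⟩, Finset.mem_univ _, rfl⟩

lemma IsFibreGroup.sum_sq_measureReal_cyl (h : IsFibreGroup E φ θ D) (hμE : μ (TMC E) = 1)
    (hΦ : MeasurePreserving (CA φ) μ μ) (hinv : ∀ g ∈ D, μ.map (translate θ g) = μ) (n : ℕ) :
    ∑ w : Fin (n + 2) → G, Nat.card D * μ.real (cyl w) ^ 2 =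
      ∑ v : Fin (n + 1) → G, μ.real (cyl v) ^ 2 := by
  classical
  rw [← Finset.sum_fiberwise (s := Finset.univ) (g := wordImage φ)]
  refine Finset.sum_congr rfl fun v _ => ?_
  rw [pow_two, ← congrArg (· * μ.real (cyl v)) (measureReal_cyl_eq_sum hΦ v).symm, Finset.sum_mul]
  refine Finset.sum_congr rfl fun w hw => ?_
  by_cases hp : IsPath E w
  · rw [← (Finset.mem_filter.1 hw).2, h.measureReal_cyl_wordImage hμE hΦ hinv hp]
    ring
  · rw [measureReal_cyl_of_not_isPath hμE hp]
    ring

lemma IsFibreGroup.measureReal_cyl_cons (h : IsFibreGroup E φ θ D) (hμE : μ (TMC E) = 1)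
    (hΦ : MeasurePreserving (CA φ) μ μ) (hS : MeasurePreserving shiftMap μ μ)
    (hpred : ∀ b, {a | (a, b) ∈ E}.ncard = Nat.card D)
    (hinv : ∀ g ∈ D, μ.map (translate θ g) = μ) {n : ℕ} (a : G) (w : Fin (n + 1) → G) :
    μ.real (cyl (Fin.cons a w : Fin (n + 2) → G)) =
      {a | (a, w 0) ∈ E}.indicator (fun _ => 1) a * (μ.real (cyl w) / Nat.card D) := by
  classical
  have hD : (Nat.card D : ℝ) ≠ 0 := by exact_mod_cast Nat.card_pos.ne'
  have hterm : ∀ w : Fin (n + 1) → G,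
      ∑ a, (μ.real (cyl (Fin.cons a w : Fin (n + 2) → G)) -
        {a | (a, w 0) ∈ E}.indicator (fun _ => 1) a * (μ.real (cyl w) / Nat.card D)) ^ 2 =
      ∑ a, μ.real (cyl (Fin.cons a w : Fin (n + 2) → G)) ^ 2 -
        μ.real (cyl w) ^ 2 / Nat.card D := by
    intro w
    have e1 : ∀ a, (μ.real (cyl (Fin.cons a w : Fin (n + 2) → G)) -
        {a | (a, w 0) ∈ E}.indicator (fun _ => 1) a * (μ.real (cyl w) / Nat.card D)) ^ 2 =
        μ.real (cyl (Fin.cons a w : Fin (n + 2) → G)) ^ 2 -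
        2 * (μ.real (cyl w) / Nat.card D) * μ.real (cyl (Fin.cons a w : Fin (n + 2) → G)) +
        (μ.real (cyl w) / Nat.card D) ^ 2 * {a | (a, w 0) ∈ E}.indicator (fun _ => 1) a := by
      intro a
      by_cases ha : (a, w 0) ∈ E
      · rw [Set.indicator_of_mem (show a ∈ {a | (a, w 0) ∈ E} from ha)]
        ring
      · rw [Set.indicator_of_notMem (show a ∉ {a | (a, w 0) ∈ E} from ha),
          measureReal_cyl_of_not_isPath hμE fun hp => ha ((isPath_cons a w).1 hp).1]
        ring
    rw [Finset.sum_congr rfl fun a _ => e1 a, Finset.sum_add_distrib, Finset.sum_sub_distrib,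
      ← Finset.mul_sum, ← Finset.mul_sum, sum_measureReal_cyl_cons hS, sum_indicator_one, hpred]
    field_simp
    ring
  have htot : ∑ w : Fin (n + 1) → G, ∑ a, (μ.real (cyl (Fin.cons a w : Fin (n + 2) → G)) -
      {a | (a, w 0) ∈ E}.indicator (fun _ => 1) a * (μ.real (cyl w) / Nat.card D)) ^ 2 = 0 := by
    rw [Finset.sum_congr rfl fun w _ => hterm w, Finset.sum_sub_distrib, ← sum_fin_succ
      (fun w : Fin (n + 2) → G => μ.real (cyl w) ^ 2), ← Finset.sum_div,
      ← h.sum_sq_measureReal_cyl hμE hΦ hinv n, ← Finset.mul_sum, mul_div_cancel_left₀ _ hD,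
      sub_self]
  have h1 := (Finset.sum_eq_zero_iff_of_nonneg fun w _ => Finset.sum_nonneg fun a _ =>
    sq_nonneg _).1 htot w (Finset.mem_univ _)
  have h2 := (Finset.sum_eq_zero_iff_of_nonneg fun a _ => sq_nonneg _).1 h1 a (Finset.mem_univ _)
  exact sub_eq_zero.1 (pow_eq_zero_iff two_ne_zero |>.1 h2)

/-- A function on an irreducible chain which is the average of its values at the successors is
constant. -/
lemma eq_of_average_eq {G : Type*} [Fintype G] {E : Set (G × G)} (hirr : IrreducibleTMC E)
    {d : ℕ} (hsucc : ∀ a, {b | (a, b) ∈ E}.ncard = d) {f : G → ℝ}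
    (hf : ∀ a, d * f a = ∑ b, {b | (a, b) ∈ E}.indicator (fun _ => 1) b * f b) (a b : G) :
    f a = f b := by
  have : Nonempty G := ⟨a⟩
  obtain ⟨m, hm⟩ := Finite.exists_max f
  have step : ∀ u v, (u, v) ∈ E → f u = f m → f v = f m := by
    intro u v huv hu
    have hsum : ∑ b, {b | (u, b) ∈ E}.indicator (fun _ => (1 : ℝ)) b * (f m - f b) = 0 := by
      simp only [mul_sub, Finset.sum_sub_distrib, ← Finset.sum_mul]
      rw [sum_indicator_one, hsucc, ← hf, hu, sub_self]
    have := (Finset.sum_eq_zero_iff_of_nonneg fun b _ => mul_nonneg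
      (Set.indicator_nonneg (fun _ _ => zero_le_one) _) (sub_nonneg.2 (hm b))).1 hsum v
      (Finset.mem_univ v)
    rw [Set.indicator_of_mem (show v ∈ {b | (u, b) ∈ E} from huv), one_mul] at this
    linarith
  suffices H : ∀ v, f v = f m from (H a).trans (H b).symm
  intro v
  obtain ⟨x, hx, i, j, hij, hi, rfl⟩ := hirr m v
  have : ∀ n : ℕ, f (x (i + n)) = f m := by
    intro n
    induction n with
    | zero => simp [hi]
    | succ n ih =>
      refine step _ _ ?_ ih
      have := hx (i + n)
      rwa [add_assoc] at this
  rw [show j = i + (j - i).toNat by omega]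
  exact this _

lemma IsFibreGroup.isParryMeasure (h : IsFibreGroup E φ θ D) (hirr : IrreducibleTMC E)
    (hμE : μ (TMC E) = 1)
    (hΦ : MeasurePreserving (CA φ) μ μ) (hS : MeasurePreserving shiftMap μ μ)
    (hsucc : ∀ a, {b | (a, b) ∈ E}.ncard = Nat.card D)
    (hpred : ∀ b, {a | (a, b) ∈ E}.ncard = Nat.card D)
    (hinv : ∀ g ∈ D, μ.map (translate θ g) = μ) : IsParryMeasure E μ := by
  have hD : (0 : ℝ) < Nat.card D := by exact_mod_cast Nat.card_pos
  have hG : (0 : ℝ) < Fintype.card G := by exact_mod_cast Fintype.card_pos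
  have hcons := fun {n : ℕ} (a : G) (w : Fin (n + 1) → G) =>
    h.measureReal_cyl_cons hμE hΦ hS hpred hinv a w
  have hconst := eq_of_average_eq hirr hsucc (f := fun a => μ.real (cyl fun _ : Fin 1 => a)) (by
    intro a
    have : μ.real (cyl fun _ : Fin 1 => a) =
        ∑ b, μ.real (cyl (Fin.cons a fun _ : Fin 1 => b : Fin 2 → G)) := by
      rw [measureReal_preimage_eq_sum (measurable_pi_apply (1 : ℤ)) _ (measurableSet_cyl _)]
      refine Finset.sum_congr rfl fun b _ => congrArg _ (Set.ext fun x => ?_)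
      rw [mem_cyl_cons]
      simp [cyl, shiftMap, and_comm]
    rw [this, Finset.mul_sum]
    refine Finset.sum_congr rfl fun b _ => ?_
    rw [hcons]
    field_simp
    rw [mul_comm]
    rfl)
  have hone : ∀ a, μ.real (cyl fun _ : Fin 1 => a) = (Fintype.card G : ℝ)⁻¹ := by
    intro a
    have : ∑ b : G, μ.real (cyl fun _ : Fin 1 => b) = 1 := by
      have := measureReal_preimage_eq_sum (μ := μ) (measurable_pi_apply (0 : ℤ)) Set.univ
        MeasurableSet.univ
      rw [probReal_univ] at this
      rw [this]
      refine Finset.sum_congr rfl fun b _ => congrArg _ (Set.ext fun x => ?_)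
      simp [cyl]
    rw [Finset.sum_congr rfl fun b _ => hconst b a, Finset.sum_const, Finset.card_univ,
      nsmul_eq_mul] at this
    exact eq_inv_of_mul_eq_one_right this
  have hall : ∀ (m : ℕ) (w : Fin (m + 1) → G), IsPath E w →
      μ.real (cyl w) = (Fintype.card G : ℝ)⁻¹ / Nat.card D ^ m := by
    intro m
    induction m with
    | zero =>
      intro w _
      rw [pow_zero, div_one, ← hone (w 0)]
      congr 2
      ext i
      rw [Fin.fin_one_eq_zero i]
    | succ m ih =>
      intro w
      obtain ⟨a, w, rfl⟩ : ∃ a v, w = Fin.cons a v := ⟨w 0, Fin.tail w, (Fin.cons_self_tail w).symm⟩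
      intro hw
      rw [isPath_cons] at hw
      rw [hcons, Set.indicator_of_mem (show a ∈ {a | (a, w 0) ∈ E} from hw.1), ih w hw.2,
        pow_succ]
      field_simp
  refine ⟨inferInstance, hS.map_eq, Nat.card D, fun _ => 1, fun _ => (Fintype.card G : ℝ)⁻¹, hD,
    fun _ => one_pos, fun _ => inv_pos.2 hG, fun a => ?_, fun b => ?_, ?_, fun m w hw => ?_⟩
  · rw [← hsucc a, ← sum_indicator_one, mul_one]
    rfl
  · rw [← hpred b, ← sum_indicator_one, Finset.sum_mul]
    refine Finset.sum_congr rfl fun a _ => ?_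
    by_cases hab : (a, b) ∈ E
    · rw [Set.indicator_of_mem hab, Set.indicator_of_mem (show a ∈ {a | (a, b) ∈ E} from hab),
        one_mul]
    · rw [Set.indicator_of_notMem hab,
        Set.indicator_of_notMem (show a ∉ {a | (a, b) ∈ E} from hab), zero_mul]
  · simp [hG.ne']
  · rw [mul_one]
    exact hall m w hw.isPath

end

lemma ergodic_shiftMap {G : Type*} [MeasurableSpace G] {μ : Measure (ℤ → G)}
    [IsProbabilityMeasure μ] (hS : MeasurePreserving shiftMap μ μ)
    (herg : ∀ s : Set (ℤ → G), MeasurableSet s → shiftMap ⁻¹' s = s → μ s = 0 ∨ μ s = 1) :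
    Ergodic (shiftMap : (ℤ → G) → ℤ → G) μ := by
  refine ⟨hS, ⟨fun s hs hss => eventuallyConst_set'.2 ?_⟩⟩
  refine (herg s hs hss).imp (fun h0 => ae_eq_empty.2 h0) fun h1 => ?_
  exact eventuallyEq_univ.2 ((prob_compl_eq_zero_iff hs).2 h1)

end CAStmt

/-- Theorem: rigidity for SC affine c.a. on irreducible TMC of entropy
`log p`, `p` prime. -/
theorem CAStmt.stmt18 {G : Type} [Fintype G] [AddCommGroup G]
    [MeasurableSpace G] [MeasurableSingletonClass G]
    (E : Set (G × G)) (hE : EveryLetterOccurs E) (hirr : IrreducibleTMC E)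
    (φ : G → G → G) (hSC : SC E φ)
    (η ρa : G ≃+ G) (hcomm : ∀ a, η (ρa a) = ρa (η a)) (c : G)
    (hφ : ∀ a b, φ a b = η a + ρa b + c)
    (p : ℕ) (hp : p.Prime)
    (hent : Tendsto (fun m : ℕ => Real.log ({w : Fin m → G | WordIn (TMC E) w}.ncard) / m)
      atTop (nhds (Real.log p)))
    (μ : Measure (ℤ → G)) [IsProbabilityMeasure μ] (hμG : μ (TMC E) = 1)
    (hμΦ : Measure.map (CA φ) μ = μ) (hμσ : Measure.map shiftMap μ = μ)
    (herg : ∀ s : Set (ℤ → G), MeasurableSet s → shiftMap ⁻¹' s = s → μ s = 0 ∨ μ s = 1)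
    (hpos : KSEntropyPos μ (CA φ)) :
    IsParryMeasure E μ := by
  obtain ⟨θ, D, hfib, hsucc, hpred⟩ := exists_isFibreGroup hE hirr hSC η ρa c hφ
  have hDp : Nat.card D = p := eq_of_tendsto_log_ncard hE Nat.card_pos hp.pos hpred hent
  have hΦ : MeasurePreserving (CA φ) μ μ :=
    ⟨measurable_pi_lambda _ fun j =>
      Measurable.comp (g := fun q : G × G => φ q.1 q.2) (f := fun x : ℤ → G => (x j, x (j + 1)))
        (measurable_of_finite _) ((measurable_pi_apply j).prodMk (measurable_pi_apply (j + 1))),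
      hμΦ⟩
  have hS : MeasurePreserving shiftMap μ μ := ⟨measurable_shiftMap, hμσ⟩
  by_cases hns : ∀ g ∈ D, g ≠ 0 → μ.map (translate θ g) ⟂ₘ μ
  · refine absurd hpos (not_KSEntropyPos hS hΦ (fun a b b' hb => ?_) fun ε hε =>
      hfib.exists_decoder hμG hS hns hε)
    simpa [hφ] using hb
  · push Not at hns
    obtain ⟨g, hg, hg0, hns⟩ := hns
    exact hfib.isParryMeasure hirr hμG hΦ hS hsucc hpred fun g' hg' =>
      hfib.map_translate_eq_of_not_mutuallySingular (ergodic_shiftMap hS herg) hΦ hp hDp hg hg0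
        hns hg'
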